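/- Let 0 < p ≤ 2. For every n ≥ 1 and all real scalars a_1, …, a_n, not all zero, the sum S = a_1 ξ_1 + … + a_n ξ_n of independent random vectors uniform on the unit sphere S^3 in ℝ^4 satisfies E|S|^{-p} ≤ 2^{p/2} Γ(2 - p/2) · (a_1² + … + a_n²)^{-p/2}. -/

import Mathlib

open MeasureTheory Real Set
open scoped ENNReal

/-- `μ` is the uniform probability measure on the unit sphere `S^{d-1}` in `ℝ^d`:
it is supported on the unit sphere and invariant under every orthogonal map. -/
def IsUniformOnSphere {d : ℕ} (μ : Measure (EuclideanSpace ℝ (Fin d))) : Prop :=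
  μ (Metric.sphere (0 : EuclideanSpace ℝ (Fin d)) 1)ᶜ = 0 ∧
  ∀ Q : EuclideanSpace ℝ (Fin d) ≃ₗᵢ[ℝ] EuclideanSpace ℝ (Fin d), μ.map ⇑Q = μ

/-- The entire function `∑ (-x)ᵏ / (k! (k + b)!)`; up to scaling, `x ^ b` times its value at
`x ^ 2` is a Bessel function of the first kind of order `b`. -/
noncomputable def besselSeries (b : ℕ) (x : ℝ) : ℝ :=
  ∑' k : ℕ, (-x) ^ k / (k.factorial * (k + b).factorial)

lemma summable_besselSeries (b : ℕ) (x : ℝ) :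
    Summable fun k : ℕ => (-x) ^ k / ((k.factorial : ℝ) * (k + b).factorial) := by
  refine Summable.of_norm_bounded (Real.summable_pow_div_factorial |x|) fun k => ?_
  rw [norm_div, norm_pow, norm_neg, Real.norm_eq_abs, norm_mul]
  simp only [Real.norm_natCast]
  gcongr
  have h : (1 : ℝ) ≤ (k + b).factorial := by exact_mod_cast Nat.factorial_pos _
  have h' : (0 : ℝ) < k.factorial := by exact_mod_cast Nat.factorial_pos _
  nlinarith

lemma hasSum_besselSeries (b : ℕ) (x : ℝ) :
    HasSum (fun k : ℕ => (-x) ^ k / ((k.factorial : ℝ) * (k + b).factorial))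
      (besselSeries b x) :=
  (summable_besselSeries b x).hasSum

lemma besselSeries_zero (b : ℕ) : besselSeries b 0 = 1 / b.factorial := by
  rw [besselSeries, tsum_eq_single 0]
  · simp
  · intro k hk
    simp [hk]

lemma hasDerivAt_besselSeries (b : ℕ) (x : ℝ) :
    HasDerivAt (besselSeries b) (-besselSeries (b + 1) x) x := by
  set R := |x| + 1
  have hR : 0 ≤ R := by positivity
  let g' : ℕ → ℝ → ℝ := fun k y =>
    (k * (-y) ^ (k - 1) * (-1)) / ((k.factorial : ℝ) * (k + b).factorial)
  have hsucc : ∀ (k : ℕ) (y : ℝ), g' (k + 1) y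
      = -((-y) ^ k / ((k.factorial : ℝ) * (k + (b + 1)).factorial)) := by
    intro k y
    have h1 : ((k + 1 + b).factorial : ℝ) = (k + (b + 1)).factorial := by
      rw [show k + 1 + b = k + (b + 1) by ring]
    have h2 : ((k + 1).factorial : ℝ) = (k + 1) * k.factorial := by
      rw [Nat.factorial_succ]; push_cast; ring
    have h3 : (0 : ℝ) < k.factorial := by exact_mod_cast Nat.factorial_pos _
    have h4 : (0 : ℝ) < (k + (b + 1)).factorial := by exact_mod_cast Nat.factorial_pos _
    simp only [g', h1, h2]
    push_cast
    field_simp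
  have key := hasDerivAt_tsum_of_isPreconnected (𝕜 := ℝ) (F := ℝ)
    (u := fun k : ℕ => k * R ^ (k - 1) / (k.factorial : ℝ))
    (g := fun (k : ℕ) y => (-y) ^ k / ((k.factorial : ℝ) * (k + b).factorial))
    (g' := g') (t := Metric.ball 0 R) (y₀ := 0) (y := x) ?_ Metric.isOpen_ball
    (convex_ball 0 R).isPreconnected ?_ ?_ ?_ (summable_besselSeries b 0) ?_
  · refine HasDerivAt.congr_deriv (f := besselSeries b) key ?_
    have hs : Summable fun k => g' (k + 1) x := by
      simp only [hsucc]
      exact (summable_besselSeries (b + 1) x).neg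
    have h0 : g' 0 x = 0 := by simp [g']
    rw [((summable_nat_add_iff (f := fun k => g' k x) 1).1 hs).tsum_eq_zero_add, h0, zero_add]
    simp only [hsucc, tsum_neg, besselSeries]
  · refine (summable_nat_add_iff 1).1 ?_
    refine (Real.summable_pow_div_factorial R).congr fun k => ?_
    have h2 : ((k + 1).factorial : ℝ) = (k + 1) * k.factorial := by
      rw [Nat.factorial_succ]; push_cast; ring
    have h3 : (0 : ℝ) < k.factorial := by exact_mod_cast Nat.factorial_pos _
    simp only [h2, Nat.add_sub_cancel]
    push_cast
    field_simp
  · intro k y _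
    have := (((hasDerivAt_id y).neg).pow k).div_const ((k.factorial : ℝ) * (k + b).factorial)
    simpa [g'] using this
  · intro k y hy
    have hy' : |y| ≤ R := by
      have := Metric.mem_ball.1 hy
      rw [Real.dist_eq, sub_zero] at this
      exact this.le
    have h : (1 : ℝ) ≤ (k + b).factorial := by exact_mod_cast Nat.factorial_pos _
    have h' : (0 : ℝ) < k.factorial := by exact_mod_cast Nat.factorial_pos _
    simp only [g', norm_div, norm_mul, norm_pow, norm_neg, Real.norm_eq_abs, Nat.abs_cast,
      abs_one, mul_one]
    gcongr
    nlinarith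
  · simp [Metric.mem_ball]; positivity
  · simp [Metric.mem_ball, R]

lemma continuous_besselSeries (b : ℕ) : Continuous (besselSeries b) :=
  continuous_iff_continuousAt.2 fun x => (hasDerivAt_besselSeries b x).continuousAt

lemma besselSeries_recurrence (b : ℕ) (x : ℝ) :
    x * besselSeries (b + 2) x - (b + 1) * besselSeries (b + 1) x + besselSeries b x = 0 := by
  have h0 := hasSum_besselSeries b x
  have h1 := (hasSum_besselSeries (b + 1) x).mul_left (-((b : ℝ) + 1))
  have h2 := (hasSum_besselSeries (b + 2) x).mul_left x
  have h01 := h0.add h1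
  have hz : (fun k : ℕ => (-x) ^ k / ((k.factorial : ℝ) * (k + b).factorial)
      + -((b : ℝ) + 1) * ((-x) ^ k / ((k.factorial : ℝ) * (k + (b + 1)).factorial))) 0 = 0 := by
    have h3 : (0 : ℝ) < b.factorial := by exact_mod_cast Nat.factorial_pos _
    have : (((0 : ℕ) + (b + 1)).factorial : ℝ) = (b + 1) * b.factorial := by
      rw [zero_add, Nat.factorial_succ]; push_cast; ring
    simp only [this]
    have hb : (b : ℝ) + 1 ≠ 0 := by positivity
    simp
    field_simp
    ring
  rw [← hasSum_nat_add_iff' 1, Finset.sum_range_one] at h01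
  beta_reduce at hz
  rw [hz, sub_zero] at h01
  have h3 := h01.add h2
  have : (fun k : ℕ => ((-x) ^ (k + 1) / (((k + 1).factorial : ℝ) * (k + 1 + b).factorial)
      + -((b : ℝ) + 1) * ((-x) ^ (k + 1) / (((k + 1).factorial : ℝ)
        * (k + 1 + (b + 1)).factorial)))
      + x * ((-x) ^ k / ((k.factorial : ℝ) * (k + (b + 2)).factorial))) = fun _ => 0 := by
    funext k
    have e1 : ((k + 1).factorial : ℝ) = (k + 1) * k.factorial := by
      rw [Nat.factorial_succ]; push_cast; ring
    have e2 : ((k + 1 + (b + 1)).factorial : ℝ) = (k + b + 2) * (k + 1 + b).factorial := by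
      rw [show k + 1 + (b + 1) = (k + 1 + b) + 1 by ring, Nat.factorial_succ]; push_cast; ring
    have e3 : ((k + (b + 2)).factorial : ℝ) = (k + b + 2) * (k + 1 + b).factorial := by
      rw [show k + (b + 2) = (k + 1 + b) + 1 by ring, Nat.factorial_succ]; push_cast; ring
    rw [e1, e2, e3]
    have p1 : (0 : ℝ) < k.factorial := by exact_mod_cast Nat.factorial_pos _
    have p2 : (0 : ℝ) < (k + 1 + b).factorial := by exact_mod_cast Nat.factorial_pos _
    have p3 : (0 : ℝ) < (k : ℝ) + 1 := by positivity
    have p4 : (0 : ℝ) < (k : ℝ) + b + 2 := by positivity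
    field_simp
    ring
  rw [this] at h3
  have := h3.unique hasSum_zero
  linarith

lemma hasDerivAt_besselSeries_energy (b : ℕ) (x : ℝ) :
    HasDerivAt (fun x => besselSeries b x ^ 2 + x * besselSeries (b + 1) x ^ 2)
      (-(2 * b + 1) * besselSeries (b + 1) x ^ 2) x := by
  have := ((hasDerivAt_besselSeries b x).pow 2).add
    ((hasDerivAt_id x).mul ((hasDerivAt_besselSeries (b + 1) x).pow 2))
  refine this.congr_deriv ?_
  have hr := besselSeries_recurrence b x
  have : besselSeries b x = (b + 1) * besselSeries (b + 1) x - x * besselSeries (b + 2) x := by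
    linarith
  rw [this]
  simp only [id, show b + 1 + 1 = b + 2 by ring, Pi.pow_apply]
  push_cast
  ring

lemma antitoneOn_besselSeries_energy (b : ℕ) :
    AntitoneOn (fun x => besselSeries b x ^ 2 + x * besselSeries (b + 1) x ^ 2) (Ici 0) := by
  have hd := hasDerivAt_besselSeries_energy b
  refine antitoneOn_of_deriv_nonpos (convex_Ici 0)
    (fun x _ => (hd x).continuousAt.continuousWithinAt)
    (fun x _ => (hd x).differentiableAt.differentiableWithinAt) fun x _ => ?_
  rw [(hd x).deriv]
  have : 0 ≤ besselSeries (b + 1) x ^ 2 := sq_nonneg _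
  have : (0 : ℝ) ≤ 2 * b + 1 := by positivity
  nlinarith

lemma abs_besselSeries_le (b : ℕ) {x : ℝ} (hx : 0 ≤ x) :
    |besselSeries b x| ≤ 1 / b.factorial := by
  have h := antitoneOn_besselSeries_energy b (mem_Ici.2 le_rfl) (mem_Ici.2 hx) hx
  simp only [zero_mul, add_zero, besselSeries_zero] at h
  refine abs_le_of_sq_le_sq ?_ (by positivity)
  nlinarith [mul_nonneg hx (sq_nonneg (besselSeries (b + 1) x))]

lemma besselSeries_alternating (n b : ℕ) {x : ℝ} (hx : 0 ≤ x) :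
    0 ≤ (-1) ^ (n + 1) * (besselSeries b x - ∑ k ∈ Finset.range (n + 1),
      (-x) ^ k / ((k.factorial : ℝ) * (k + b).factorial)) := by
  induction n generalizing b x with
  | zero =>
    have := (abs_le.1 (abs_besselSeries_le b hx)).2
    simp at this ⊢
    linarith
  | succ n ih =>
    set F : ℝ → ℝ := fun x => (-1) ^ (n + 1 + 1) * (besselSeries b x -
      ∑ k ∈ Finset.range (n + 1 + 1), (-x) ^ k / ((k.factorial : ℝ) * (k + b).factorial))
    have hd : ∀ y, HasDerivAt F ((-1) ^ (n + 1) * (besselSeries (b + 1) y -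
        ∑ k ∈ Finset.range (n + 1),
          (-y) ^ k / ((k.factorial : ℝ) * (k + (b + 1)).factorial))) y := by
      intro y
      have hterm : ∀ k ∈ Finset.range (n + 1 + 1), HasDerivAt
          (fun x : ℝ => (-x) ^ k / ((k.factorial : ℝ) * (k + b).factorial))
          ((k * (-y) ^ (k - 1) * (-1)) / ((k.factorial : ℝ) * (k + b).factorial)) y := by
        intro k _
        have := (((hasDerivAt_id y).neg).pow k).div_const
          ((k.factorial : ℝ) * (k + b).factorial)
        simpa using this
      have := ((hasDerivAt_besselSeries b y).sub (HasDerivAt.fun_sum hterm)).const_mul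
        ((-1 : ℝ) ^ (n + 1 + 1))
      refine this.congr_deriv ?_
      rw [Finset.sum_range_succ']
      have : ∀ k ∈ Finset.range (n + 1), ((k + 1 : ℕ) * (-y) ^ (k + 1 - 1) * (-1))
          / (((k + 1).factorial : ℝ) * (k + 1 + b).factorial)
          = -((-y) ^ k / ((k.factorial : ℝ) * (k + (b + 1)).factorial)) := by
        intro k _
        have h1 : ((k + 1 + b).factorial : ℝ) = (k + (b + 1)).factorial := by
          rw [show k + 1 + b = k + (b + 1) by ring]
        have h2 : ((k + 1).factorial : ℝ) = (k + 1) * k.factorial := by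
          rw [Nat.factorial_succ]; push_cast; ring
        have h3 : (0 : ℝ) < k.factorial := by exact_mod_cast Nat.factorial_pos _
        have h4 : (0 : ℝ) < (k + (b + 1)).factorial := by exact_mod_cast Nat.factorial_pos _
        rw [h1, h2]
        push_cast
        field_simp
      rw [Finset.sum_congr rfl this, Finset.sum_neg_distrib]
      simp
      ring
    have hmono : MonotoneOn F (Ici 0) := by
      refine monotoneOn_of_deriv_nonneg (convex_Ici 0)
        (fun x _ => (hd x).continuousAt.continuousWithinAt)
        (fun x _ => (hd x).differentiableAt.differentiableWithinAt) fun y hy => ?_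
      rw [(hd y).deriv]
      rw [interior_Ici] at hy
      exact ih (b + 1) (le_of_lt hy)
    have h := hmono (mem_Ici.2 le_rfl) (mem_Ici.2 hx) hx
    have h0 : F 0 = 0 := by
      simp only [F, besselSeries_zero]
      rw [Finset.sum_range_succ']
      simp
    rw [h0] at h
    exact h

lemma besselSeries_one_pos {x : ℝ} (hx : 0 ≤ x) (hx' : x ≤ 18 / 5) : 0 < besselSeries 1 x := by
  have h := besselSeries_alternating 5 1 hx
  obtain ⟨y, rfl⟩ : ∃ y, x = 18 / 5 - y := ⟨18 / 5 - x, by ring⟩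
  have hy : 0 ≤ y := by linarith
  simp only [Finset.sum_range_succ, Finset.sum_range_zero, Nat.factorial, Nat.cast_mul,
    Nat.cast_one, Nat.reduceAdd] at h
  norm_num at h
  refine lt_of_lt_of_le ?_ h
  ring_nf
  positivity

lemma besselSeries_two_nonneg {x : ℝ} (hx : 0 ≤ x) (hx' : x ≤ 6) : 0 ≤ besselSeries 2 x := by
  have h := besselSeries_alternating 5 2 hx
  obtain ⟨y, rfl⟩ : ∃ y, x = 6 - y := ⟨6 - x, by ring⟩
  have hy : 0 ≤ y := by linarith
  simp only [Finset.sum_range_succ, Finset.sum_range_zero, Nat.factorial, Nat.cast_mul,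
    Nat.cast_one, Nat.reduceAdd] at h
  norm_num at h
  refine le_trans ?_ h
  ring_nf
  positivity

lemma besselSeries_zero_eq (x : ℝ) :
    besselSeries 0 x = besselSeries 1 x - x * besselSeries 2 x := by
  have := besselSeries_recurrence 0 x
  simp at this
  linarith

/-- Numerical enclosures at `18 / 5`. -/
lemma besselSeries_at_eighteen_fifths :
    |besselSeries 1 (18 / 5) - 0.0078847| ≤ 0.000001 ∧
      |besselSeries 2 (18 / 5) - 0.1139911| ≤ 0.000001 := by
  have h1 := besselSeries_alternating 9 1 (x := 18 / 5) (by norm_num)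
  have h2 := besselSeries_alternating 10 1 (x := 18 / 5) (by norm_num)
  have h3 := besselSeries_alternating 9 2 (x := 18 / 5) (by norm_num)
  have h4 := besselSeries_alternating 10 2 (x := 18 / 5) (by norm_num)
  simp only [Finset.sum_range_succ, Finset.sum_range_zero, Nat.factorial, Nat.cast_mul,
    Nat.cast_one, Nat.reduceAdd] at h1 h2 h3 h4
  norm_num at h1 h2 h3 h4
  constructor <;> rw [abs_le] <;> constructor <;> norm_num <;> linarith

lemma besselSeries_at_six :
    |besselSeries 1 6 + 0.128413| ≤ 0.00001 ∧ |besselSeries 2 6 - 0.0136077| ≤ 0.00001 := by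
  have h1 := besselSeries_alternating 11 1 (x := 6) (by norm_num)
  have h2 := besselSeries_alternating 12 1 (x := 6) (by norm_num)
  have h3 := besselSeries_alternating 11 2 (x := 6) (by norm_num)
  have h4 := besselSeries_alternating 12 2 (x := 6) (by norm_num)
  simp only [Finset.sum_range_succ, Finset.sum_range_zero, Nat.factorial, Nat.cast_mul,
    Nat.cast_one, Nat.reduceAdd] at h1 h2 h3 h4
  norm_num at h1 h2 h3 h4
  constructor <;> rw [abs_le] <;> constructor <;> norm_num <;> linarith

lemma exp_neg_two_ge : 0.1353 ≤ exp (-2 : ℝ) := by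
  have := Real.exp_one_lt_d9
  have h : exp (-2 : ℝ) = ((exp 1) ^ 2)⁻¹ := by
    rw [← Real.exp_nat_mul, ← Real.exp_neg]; norm_num
  rw [h, le_inv_comm₀ (by norm_num) (by positivity)]
  have h0 := Real.exp_pos 1
  nlinarith

lemma abs_besselSeries_one_le_exp_neg_two {x : ℝ} (hx : 18 / 5 ≤ x) :
    |besselSeries 1 x| ≤ exp (-2) := by
  obtain ⟨h1, -⟩ := besselSeries_at_eighteen_fifths
  obtain ⟨h2, h3⟩ := besselSeries_at_six
  have he := exp_neg_two_ge
  rw [abs_le] at h1 h2 h3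
  rcases le_total x 6 with h6 | h6
  · have hanti : AntitoneOn (besselSeries 1) (Icc 0 6) := by
      refine antitoneOn_of_deriv_nonpos (convex_Icc 0 6)
        (continuous_besselSeries 1).continuousOn
        (fun x _ => (hasDerivAt_besselSeries 1 x).differentiableAt.differentiableWithinAt)
        fun y hy => ?_
      rw [interior_Icc] at hy
      rw [(hasDerivAt_besselSeries 1 y).deriv]
      linarith [besselSeries_two_nonneg hy.1.le hy.2.le]
    have a1 := hanti (a := 18 / 5) (b := x) ⟨by norm_num, by norm_num⟩ ⟨by linarith, h6⟩ hx
    have a2 := hanti (a := x) (b := 6) ⟨by linarith, h6⟩ ⟨by norm_num, by norm_num⟩ h6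
    rw [abs_le]
    constructor <;> linarith
  · have h := antitoneOn_besselSeries_energy 1 (mem_Ici.2 (by norm_num : (0 : ℝ) ≤ 6))
      (mem_Ici.2 (by linarith : 0 ≤ x)) h6
    simp only [Nat.reduceAdd] at h
    refine abs_le_of_sq_le_sq ?_ (Real.exp_pos _).le
    have hx0 : 0 ≤ x * besselSeries 2 x ^ 2 := by positivity
    have : (0.1353 : ℝ) ^ 2 ≤ exp (-2) ^ 2 := by gcongr
    nlinarith

lemma besselSeries_one_le_exp {x : ℝ} (hx : 0 ≤ x) (hx' : x ≤ 18 / 5) :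
    besselSeries 1 x ≤ exp (-(x / 2 + x ^ 2 / 24)) := by
  set W : ℝ → ℝ := fun x => x ^ 2 * (-besselSeries 2 x + (1 / 2 + x / 12) * besselSeries 1 x)
    * exp (-(x / 2 + x ^ 2 / 24)) with hW
  have hE : ∀ x : ℝ, HasDerivAt (fun x : ℝ => x / 2 + x ^ 2 / 24) (1 / 2 + x / 12) x := by
    intro x
    refine (((hasDerivAt_id x).div_const 2).add ((hasDerivAt_pow 2 x).div_const 24)).congr_deriv ?_
    push_cast
    ring
  have hWd : ∀ x, HasDerivAt W
      (-(x ^ 3 / 12 + x ^ 4 / 144) * besselSeries 1 x * exp (-(x / 2 + x ^ 2 / 24))) x := by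
    intro x
    have h1 := hasDerivAt_besselSeries 1 x
    have h2 := hasDerivAt_besselSeries 2 x
    have hl : HasDerivAt (fun x : ℝ => 1 / 2 + x / 12) (1 / 12) x := by
      simpa using ((hasDerivAt_id x).div_const 12).const_add (1 / 2)
    have := (((hasDerivAt_pow 2 x).mul (h2.neg.add (hl.mul h1)))).mul (hE x).neg.exp
    refine this.congr_deriv ?_
    have hr := besselSeries_recurrence 1 x
    have : besselSeries 1 x = 2 * besselSeries 2 x - x * besselSeries 3 x := by
      push_cast at hr; linarith
    simp only [Pi.mul_apply, Pi.add_apply, Pi.neg_apply, Nat.reduceAdd]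
    rw [this]
    push_cast
    ring
  have hWanti : AntitoneOn W (Icc 0 (18 / 5)) := by
    refine antitoneOn_of_deriv_nonpos (convex_Icc 0 _)
      (fun x _ => (hWd x).continuousAt.continuousWithinAt)
      (fun x _ => (hWd x).differentiableAt.differentiableWithinAt) fun y hy => ?_
    rw [interior_Icc] at hy
    rw [(hWd y).deriv]
    have := besselSeries_one_pos hy.1.le hy.2.le
    have hy0 : 0 < y := hy.1
    have : 0 ≤ (y ^ 3 / 12 + y ^ 4 / 144) * besselSeries 1 y * exp (-(y / 2 + y ^ 2 / 24)) := by
      positivity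
    linarith
  have hW0 : W 0 = 0 := by simp [hW]
  have hq : AntitoneOn (fun x => besselSeries 1 x * exp (x / 2 + x ^ 2 / 24))
      (Icc 0 (18 / 5)) := by
    have hd : ∀ x, HasDerivAt (fun x => besselSeries 1 x * exp (x / 2 + x ^ 2 / 24))
        ((-besselSeries 2 x + (1 / 2 + x / 12) * besselSeries 1 x)
          * exp (x / 2 + x ^ 2 / 24)) x := by
      intro x
      refine ((hasDerivAt_besselSeries 1 x).mul (hE x).exp).congr_deriv ?_
      simp only [Nat.reduceAdd]
      ring
    refine antitoneOn_of_deriv_nonpos (convex_Icc 0 _)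
      (fun x _ => (hd x).continuousAt.continuousWithinAt)
      (fun x _ => (hd x).differentiableAt.differentiableWithinAt) fun y hy => ?_
    rw [interior_Icc] at hy
    rw [(hd y).deriv]
    have hw := hWanti ⟨le_rfl, by norm_num⟩ ⟨hy.1.le, hy.2.le⟩ hy.1.le
    rw [hW0] at hw
    have hy0 : 0 < y := hy.1
    have : -besselSeries 2 y + (1 / 2 + y / 12) * besselSeries 1 y ≤ 0 := by
      by_contra! hc
      have : 0 < W y := by simp only [hW]; positivity
      linarith
    exact mul_nonpos_of_nonpos_of_nonneg this (Real.exp_pos _).le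
  have := hq ⟨le_rfl, by norm_num⟩ ⟨hx, hx'⟩ hx
  simp only [besselSeries_zero] at this
  norm_num at this
  rw [Real.exp_neg, ← one_div, le_div_iff₀ (Real.exp_pos _)]
  exact this

lemma integrableOn_pow_mul_exp_neg_mul (k : ℕ) {c : ℝ} (hc : 0 < c) :
    IntegrableOn (fun x : ℝ => x ^ k * exp (-(c * x))) (Ioi 0) := by
  have := integrableOn_rpow_mul_exp_neg_mul_rpow (s := k) (p := 1) (b := c)
    (by have : (0 : ℝ) ≤ k := k.cast_nonneg
        linarith) one_pos hc
  simpa [Real.rpow_natCast] using this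

lemma integral_pow_mul_exp_neg_mul (k : ℕ) {c : ℝ} (hc : 0 < c) :
    ∫ x in Ioi (0 : ℝ), x ^ k * exp (-(c * x)) = k.factorial / c ^ (k + 1) := by
  have := Real.integral_rpow_mul_exp_neg_mul_Ioi (a := k + 1) (r := c) (by positivity) hc
  rw [Real.Gamma_nat_eq_factorial] at this
  simp only [add_sub_cancel_right, Real.rpow_natCast] at this
  rw [this, show (k : ℝ) + 1 = ((k + 1 : ℕ) : ℝ) by push_cast; ring, Real.rpow_natCast]
  rw [one_div, inv_pow]
  field_simp

lemma setLIntegral_Ioc_le_of_hasDerivAt {F F' h : ℝ → ℝ} {a b : ℝ} (hab : a ≤ b)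
    (hF : ∀ x, HasDerivAt F (F' x) x) (hc : Continuous F')
    (h0 : ∀ x ∈ Ioc a b, 0 ≤ F' x) (hh : ∀ x ∈ Ioc a b, h x ≤ F' x) :
    ∫⁻ x in Ioc a b, ENNReal.ofReal (h x) ≤ ENNReal.ofReal (F b - F a) := by
  calc ∫⁻ x in Ioc a b, ENNReal.ofReal (h x)
      ≤ ∫⁻ x in Ioc a b, ENNReal.ofReal (F' x) :=
        setLIntegral_mono' measurableSet_Ioc fun x hx => ENNReal.ofReal_le_ofReal (hh x hx)
    _ = ENNReal.ofReal (∫ x in Ioc a b, F' x) := by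
        rw [ofReal_integral_eq_lintegral_ofReal]
        · exact (hc.intervalIntegrable a b).1
        · exact (ae_restrict_iff' measurableSet_Ioc).2 (ae_of_all _ h0)
    _ = ENNReal.ofReal (F b - F a) := by
        rw [← intervalIntegral.integral_of_le hab,
          intervalIntegral.integral_eq_sub_of_hasDerivAt (fun x _ => hF x)
            (hc.intervalIntegrable a b)]

lemma setLIntegral_Ioi_besselSeries_one_sq_le {X : ℝ} (hX : 0 ≤ X) :
    ∫⁻ x in Ioi X, ENNReal.ofReal (besselSeries 1 x ^ 2)
      ≤ ENNReal.ofReal (besselSeries 0 X ^ 2 + X * besselSeries 1 X ^ 2) := by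
  have hU : Ioi X = ⋃ n : ℕ, Ioc X (X + n) := by
    ext x
    simp only [mem_Ioi, mem_iUnion, mem_Ioc]
    refine ⟨fun h => ?_, fun ⟨n, h, _⟩ => h⟩
    obtain ⟨n, hn⟩ := exists_nat_ge (x - X)
    exact ⟨n, h, by linarith⟩
  rw [hU, setLIntegral_iUnion_of_directed]
  · refine iSup_le fun n => ?_
    have hn : X ≤ X + n := by simp
    refine (setLIntegral_Ioc_le_of_hasDerivAt hn
      (F := fun x => -(besselSeries 0 x ^ 2 + x * besselSeries 1 x ^ 2))
      (F' := fun x => besselSeries 1 x ^ 2) ?_ ((continuous_besselSeries 1).pow 2)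
      (fun x _ => sq_nonneg _) fun x _ => le_rfl).trans ?_
    · intro x
      refine (hasDerivAt_besselSeries_energy 0 x).neg.congr_deriv ?_
      simp
    · apply ENNReal.ofReal_le_ofReal
      have : 0 ≤ (X + n) * besselSeries 1 (X + n) ^ 2 := by positivity
      nlinarith [sq_nonneg (besselSeries 0 (X + n))]
  · refine (Monotone.directed_le fun m n hmn => ?_)
    exact Ioc_subset_Ioc_right (by simpa using hmn)

lemma exp_neg_le_quadratic {y : ℝ} (hy : 0 ≤ y) : exp (-y) ≤ 1 - y + y ^ 2 / 2 := by
  have h := Real.quadratic_le_exp_of_nonneg hy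
  rw [Real.exp_neg, inv_le_iff_one_le_mul₀ (Real.exp_pos y)]
  have : 0 ≤ 1 - y + y ^ 2 / 2 := by nlinarith [sq_nonneg (y - 1)]
  nlinarith [mul_le_mul_of_nonneg_left h this, sq_nonneg (y ^ 2)]

/-- The value of the energy of `besselSeries 0` at `18 / 5`. -/
lemma besselSeries_energy_at_eighteen_fifths :
    |besselSeries 0 (18 / 5) ^ 2 + 18 / 5 * besselSeries 1 (18 / 5) ^ 2 - 0.1622| ≤ 0.0001 := by
  obtain ⟨h1, h2⟩ := besselSeries_at_eighteen_fifths
  rw [besselSeries_zero_eq]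
  rw [abs_le] at *
  constructor <;> nlinarith

lemma setLIntegral_Ioi_abs_besselSeries_one_rpow_le {s : ℝ} (hs : 2 ≤ s) :
    ∫⁻ x in Ioi (18 / 5), ENNReal.ofReal (|besselSeries 1 x| ^ s)
      ≤ ENNReal.ofReal (exp (-(2 * (s - 2))) *
        (besselSeries 0 (18 / 5) ^ 2 + 18 / 5 * besselSeries 1 (18 / 5) ^ 2)) := by
  have hm : Measurable fun x => ENNReal.ofReal (besselSeries 1 x ^ 2) :=
    ((continuous_besselSeries 1).pow 2).measurable.ennreal_ofReal
  calc ∫⁻ x in Ioi (18 / 5), ENNReal.ofReal (|besselSeries 1 x| ^ s)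
      ≤ ∫⁻ x in Ioi (18 / 5), ENNReal.ofReal (exp (-(2 * (s - 2)))) *
          ENNReal.ofReal (besselSeries 1 x ^ 2) := by
        refine setLIntegral_mono' measurableSet_Ioi fun x hx => ?_
        rw [← ENNReal.ofReal_mul (Real.exp_pos _).le]
        apply ENNReal.ofReal_le_ofReal
        have h := abs_besselSeries_one_le_exp_neg_two (le_of_lt hx)
        rw [show s = (s - 2) + (2 : ℕ) by push_cast; ring,
          Real.rpow_add_natCast' (abs_nonneg _) (by push_cast; linarith), sq_abs]
        gcongr
        calc |besselSeries 1 x| ^ (s - 2) ≤ exp (-2) ^ (s - 2) :=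
              Real.rpow_le_rpow (abs_nonneg _) h (by linarith)
          _ = _ := by rw [← Real.exp_mul]; push_cast; ring_nf
    _ ≤ _ := by
        rw [lintegral_const_mul _ hm, ENNReal.ofReal_mul (Real.exp_pos _).le]
        gcongr
        exact setLIntegral_Ioi_besselSeries_one_sq_le (by norm_num)

lemma setLIntegral_Ioc_besselSeries_one_rpow_le {δ : ℝ} (hδ : 0 ≤ δ) :
    ∫⁻ x in Ioc 0 (18 / 5), ENNReal.ofReal (|besselSeries 1 x| ^ (2 + δ))
      ≤ ENNReal.ofReal (1 -
        (besselSeries 0 (18 / 5) ^ 2 + 18 / 5 * besselSeries 1 (18 / 5) ^ 2)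
        - δ / 2 * 0.5953 + δ ^ 2 / 8 * 0.7285) := by
  obtain ⟨h1, h2⟩ := besselSeries_at_eighteen_fifths
  set F : ℝ → ℝ := fun x => -(besselSeries 0 x ^ 2 + x * besselSeries 1 x ^ 2)
    - δ / 2 * (x ^ 2 * besselSeries 1 x ^ 2 - x ^ 2 * besselSeries 1 x * besselSeries 2 x
      + x ^ 3 * besselSeries 2 x ^ 2)
    + δ ^ 2 / 8 * (x ^ 3 / 3 * (besselSeries 1 x ^ 2 + x * besselSeries 2 x ^ 2)) with hF
  have hd : ∀ x, HasDerivAt F (besselSeries 1 x ^ 2 *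
      (1 - δ * x / 2 + (δ * x / 2) ^ 2 / 2)) x := by
    intro x
    have j1 := hasDerivAt_besselSeries 1 x
    have j2 := hasDerivAt_besselSeries 2 x
    have x2 := hasDerivAt_pow 2 x
    have x3 := hasDerivAt_pow 3 x
    have := ((hasDerivAt_besselSeries_energy 0 x).neg.sub
      ((((x2.mul (j1.pow 2)).sub ((x2.mul j1).mul j2)).add (x3.mul (j2.pow 2))).const_mul
        (δ / 2))).add
      (((x3.div_const 3).mul (hasDerivAt_besselSeries_energy 1 x)).const_mul (δ ^ 2 / 8))
    refine this.congr_deriv ?_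
    have hr := besselSeries_recurrence 1 x
    have : besselSeries 1 x = 2 * besselSeries 2 x - x * besselSeries 3 x := by
      push_cast at hr; linarith
    simp only [Pi.mul_apply, Pi.pow_apply, Nat.reduceAdd]
    rw [this]
    push_cast
    ring
  refine (setLIntegral_Ioc_le_of_hasDerivAt (by norm_num) hd ?_ ?_ ?_).trans ?_
  · have := continuous_besselSeries 1
    fun_prop
  · intro x _
    have : 0 ≤ 1 - δ * x / 2 + (δ * x / 2) ^ 2 / 2 := by nlinarith [sq_nonneg (δ * x / 2 - 1)]
    positivity
  · intro x hx
    have hp := besselSeries_one_pos hx.1.le hx.2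
    have hx0 : 0 < x := hx.1
    rw [abs_of_pos hp, Real.rpow_add hp, Real.rpow_two]
    gcongr
    calc besselSeries 1 x ^ δ ≤ exp (-(x / 2 + x ^ 2 / 24)) ^ δ :=
          Real.rpow_le_rpow hp.le (besselSeries_one_le_exp hx.1.le hx.2) hδ
      _ ≤ exp (-(δ * x / 2)) := by
          rw [← Real.exp_mul, Real.exp_le_exp]
          nlinarith [mul_nonneg hδ (sq_nonneg x)]
      _ ≤ _ := exp_neg_le_quadratic (by positivity)
  · apply ENNReal.ofReal_le_ofReal
    have hF0 : F 0 = -1 := by simp [hF, besselSeries_zero]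
    rw [hF0, hF]
    rw [abs_le] at h1 h2
    have e1 : 0.5953 ≤ (18 / 5) ^ 2 * besselSeries 1 (18 / 5) ^ 2
        - (18 / 5) ^ 2 * besselSeries 1 (18 / 5) * besselSeries 2 (18 / 5)
        + (18 / 5) ^ 3 * besselSeries 2 (18 / 5) ^ 2 := by
      have hfk : besselSeries 1 (18 / 5) * besselSeries 2 (18 / 5) ≤ 0.0078857 * 0.1139921 :=
        mul_le_mul (by linarith) (by linarith) (by linarith) (by norm_num)
      nlinarith [sq_nonneg (besselSeries 1 (18 / 5) - 0.0078847)]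
    have e2 : (18 / 5) ^ 3 / 3 * (besselSeries 1 (18 / 5) ^ 2
        + 18 / 5 * besselSeries 2 (18 / 5) ^ 2) ≤ 0.7285 := by
      nlinarith
    have e3 := mul_le_mul_of_nonneg_left e1 (by positivity : 0 ≤ δ / 2)
    have e4 := mul_le_mul_of_nonneg_left e2 (by positivity : 0 ≤ δ ^ 2 / 8)
    linarith

lemma setLIntegral_Ioc_besselSeries_one_rpow_le' {s : ℝ} (hs : 0 < s) :
    ∫⁻ x in Ioc 0 (18 / 5), ENNReal.ofReal (|besselSeries 1 x| ^ s)
      ≤ ENNReal.ofReal (2 / s - 2 / 3 / s ^ 2 + 2 / 3 / s ^ 3) := by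
  have hs2 : 0 < s / 2 := by positivity
  have hi := fun k => integrableOn_pow_mul_exp_neg_mul k hs2
  have hint : IntegrableOn (fun x : ℝ => x ^ 0 * exp (-(s / 2 * x))
      - s / 24 * (x ^ 2 * exp (-(s / 2 * x))) + s ^ 2 / 1152 * (x ^ 4 * exp (-(s / 2 * x))))
      (Ioi 0) :=
    ((hi 0).sub ((hi 2).const_mul _)).add ((hi 4).const_mul _)
  have heq : ∀ x : ℝ, x ^ 0 * exp (-(s / 2 * x)) - s / 24 * (x ^ 2 * exp (-(s / 2 * x)))
      + s ^ 2 / 1152 * (x ^ 4 * exp (-(s / 2 * x)))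
      = exp (-(s / 2 * x)) * (1 - s * x ^ 2 / 24 + (s * x ^ 2 / 24) ^ 2 / 2) := by
    intro x; ring
  have hval : ∫ x in Ioi (0 : ℝ), (x ^ 0 * exp (-(s / 2 * x))
      - s / 24 * (x ^ 2 * exp (-(s / 2 * x))) + s ^ 2 / 1152 * (x ^ 4 * exp (-(s / 2 * x))))
      = 2 / s - 2 / 3 / s ^ 2 + 2 / 3 / s ^ 3 := by
    rw [integral_add, integral_sub, integral_const_mul, integral_const_mul,
      integral_pow_mul_exp_neg_mul 0 hs2, integral_pow_mul_exp_neg_mul 2 hs2,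
      integral_pow_mul_exp_neg_mul 4 hs2]
    · simp only [Nat.factorial]
      push_cast
      field_simp
      ring
    · exact hi 0
    · exact (hi 2).const_mul _
    · exact (hi 0).sub ((hi 2).const_mul _)
    · exact (hi 4).const_mul _
  rw [← hval, ofReal_integral_eq_lintegral_ofReal hint]
  · refine (setLIntegral_mono' measurableSet_Ioc fun x hx => ?_).trans
      (lintegral_mono_set Ioc_subset_Ioi_self)
    apply ENNReal.ofReal_le_ofReal
    rw [heq]
    have hp := besselSeries_one_pos hx.1.le hx.2
    rw [abs_of_pos hp]
    calc besselSeries 1 x ^ s ≤ exp (-(x / 2 + x ^ 2 / 24)) ^ s :=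
          Real.rpow_le_rpow hp.le (besselSeries_one_le_exp hx.1.le hx.2) hs.le
      _ = exp (-(s / 2 * x)) * exp (-(s * x ^ 2 / 24)) := by
          rw [← Real.exp_mul, ← Real.exp_add]; ring_nf
      _ ≤ _ := by
          gcongr
          exact exp_neg_le_quadratic (by positivity)
  · refine ae_of_all _ fun x => ?_
    simp only [heq, Pi.zero_apply]
    have : 0 ≤ 1 - s * x ^ 2 / 24 + (s * x ^ 2 / 24) ^ 2 / 2 := by
      nlinarith [sq_nonneg (s * x ^ 2 / 24 - 1)]
    positivity

/-- An integral inequality of Ball type in dimension four. -/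
theorem setLIntegral_Ioi_besselSeries_one_rpow_le {s : ℝ} (hs : 2 ≤ s) :
    ∫⁻ x in Ioi 0, ENNReal.ofReal (|besselSeries 1 x| ^ s) ≤ ENNReal.ofReal (2 / s) := by
  have hM := besselSeries_energy_at_eighteen_fifths
  set M := besselSeries 0 (18 / 5) ^ 2 + 18 / 5 * besselSeries 1 (18 / 5) ^ 2 with hMdef
  rw [abs_le] at hM
  have hM0 : 0 ≤ M := by linarith
  have htail := setLIntegral_Ioi_abs_besselSeries_one_rpow_le hs
  rw [← hMdef] at htail
  rw [← Ioc_union_Ioi_eq_Ioi (by norm_num : (0 : ℝ) ≤ 18 / 5)]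
  refine (lintegral_union_le _ _ _).trans ?_
  rcases le_total s (5 / 2) with hs5 | hs5
  · obtain ⟨δ, rfl⟩ : ∃ δ, s = 2 + δ := ⟨s - 2, by ring⟩
    have hδ : 0 ≤ δ := by linarith
    have hδ' : δ ≤ 1 / 2 := by linarith
    have hhead := setLIntegral_Ioc_besselSeries_one_rpow_le hδ
    rw [← hMdef] at hhead
    refine (add_le_add hhead htail).trans ?_
    rw [← ENNReal.ofReal_add (by nlinarith) (by positivity)]
    apply ENNReal.ofReal_le_ofReal
    have he : exp (-(2 * (2 + δ - 2))) ≤ 1 - 2 * δ + 2 * δ ^ 2 := by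
      refine (exp_neg_le_quadratic (by linarith)).trans (le_of_eq ?_)
      ring
    have := mul_le_mul_of_nonneg_right he hM0
    rw [le_div_iff₀ (by linarith)]
    have hq : 1 - M - δ / 2 * 0.5953 + δ ^ 2 / 8 * 0.7285 + (1 - 2 * δ + 2 * δ ^ 2) * M
        ≤ 1 - 0.6217 * δ + 0.4158 * δ ^ 2 := by
      nlinarith [mul_nonneg hδ (by linarith : 0 ≤ 1 / 2 - δ)]
    have h2 : (1 - 0.6217 * δ + 0.4158 * δ ^ 2) * (2 + δ) ≤ 2 := by
      nlinarith [mul_nonneg hδ (by linarith : 0 ≤ 1 / 2 - δ),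
        mul_nonneg (mul_nonneg hδ hδ) (by linarith : 0 ≤ 1 / 2 - δ)]
    nlinarith
  · have hs0 : 0 < s := by linarith
    have hhead := setLIntegral_Ioc_besselSeries_one_rpow_le' hs0
    refine (add_le_add hhead htail).trans ?_
    have hnn : 0 ≤ 2 / s - 2 / 3 / s ^ 2 + 2 / 3 / s ^ 3 := by
      have : 2 / s - 2 / 3 / s ^ 2 + 2 / 3 / s ^ 3 = (2 * s ^ 2 - 2 / 3 * s + 2 / 3) / s ^ 3 := by
        field_simp
      rw [this]
      apply div_nonneg _ (by positivity)
      nlinarith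
    rw [← ENNReal.ofReal_add hnn (by positivity)]
    apply ENNReal.ofReal_le_ofReal
    obtain ⟨h, rfl⟩ : ∃ h, s = 5 / 2 + h := ⟨s - 5 / 2, by ring⟩
    have hh : 0 ≤ h := by linarith
    have he : 2.718 * (1 + 2 * h + 2 * h ^ 2) ≤ exp (2 * (5 / 2 + h - 2)) := by
      rw [show 2 * (5 / 2 + h - 2) = 1 + 2 * h by ring, Real.exp_add]
      have := Real.quadratic_le_exp_of_nonneg (by positivity : 0 ≤ 2 * h)
      have h1 := Real.exp_one_gt_d9
      have : 1 + 2 * h + 2 * h ^ 2 ≤ exp (2 * h) := by nlinarith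
      gcongr
      linarith
    have hE : exp (-(2 * (5 / 2 + h - 2))) ≤ (2.718 * (1 + 2 * h + 2 * h ^ 2))⁻¹ := by
      rw [Real.exp_neg]
      gcongr
    have key : (2.718 * (1 + 2 * h + 2 * h ^ 2))⁻¹ * M
        ≤ 2 / 3 * (3 / 2 + h) / (5 / 2 + h) ^ 3 := by
      rw [inv_mul_eq_div, div_le_div_iff₀ (by positivity) (by positivity)]
      have : M * (5 / 2 + h) ^ 3 ≤ 0.1625 * (5 / 2 + h) ^ 3 := by
        gcongr
        linarith
      refine this.trans ?_
      rw [← sub_nonneg]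
      ring_nf
      positivity
    have e1 : 2 / 3 * (3 / 2 + h) / (5 / 2 + h) ^ 3
        = 2 / 3 / (5 / 2 + h) ^ 2 - 2 / 3 / (5 / 2 + h) ^ 3 := by
      field_simp
      ring
    have e2 := mul_le_mul_of_nonneg_right hE hM0
    linarith

lemma setLIntegral_Ioi_comp_mul_left {g : ℝ → ℝ≥0∞} (hg : Measurable g) {a : ℝ} (ha : 0 < a) :
    ∫⁻ x in Ioi 0, g (a * x) = ENNReal.ofReal a⁻¹ * ∫⁻ x in Ioi 0, g x := by
  have hmeas : Measurable fun x : ℝ => a * x := measurable_const_mul a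
  have h := Real.map_volume_mul_left ha.ne'
  rw [abs_of_pos (inv_pos.2 ha)] at h
  calc ∫⁻ x in Ioi 0, g (a * x)
      = ∫⁻ x, (Ioi (0 : ℝ)).indicator g (a * x) := by
        rw [← lintegral_indicator measurableSet_Ioi]
        refine lintegral_congr fun x => ?_
        by_cases hx : 0 < x
        · rw [indicator_of_mem (mem_Ioi.2 hx), indicator_of_mem (mem_Ioi.2 (mul_pos ha hx))]
        · rw [indicator_of_notMem (by simpa using hx),
            indicator_of_notMem (by simpa [ha] using not_lt.1 hx)]
    _ = ∫⁻ x, (Ioi (0 : ℝ)).indicator g x ∂(volume.map fun x => a * x) :=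
        (lintegral_map (hg.indicator measurableSet_Ioi) hmeas).symm
    _ = _ := by
        rw [h, lintegral_smul_measure, lintegral_indicator measurableSet_Ioi, smul_eq_mul]

/-- Hölder's inequality combined with `setLIntegral_Ioi_besselSeries_one_rpow_le`. -/
theorem setLIntegral_abs_prod_besselSeries_one_le {ι : Type*} [Fintype ι] {α : ι → ℝ}
    (hα : ∀ k, 0 ≤ α k) {c : ℝ} (hc : 0 < c) (h : ∀ k, 2 * α k ≤ ∑ i, α i + 2 * c) :
    ∫⁻ x in Ioi 0, ENNReal.ofReal (|∏ k, besselSeries 1 (α k * x)| * exp (-(c * x)))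
      ≤ ENNReal.ofReal (2 / (∑ i, α i + 2 * c)) := by
  set N := ∑ i, α i + 2 * c with hN
  have hN0 : 0 < N := by
    have := Finset.sum_nonneg fun i (_ : i ∈ Finset.univ) => hα i
    linarith
  let w : Option ι → ℝ := fun o => o.elim (2 * c / N) fun k => α k / N
  let F : Option ι → ℝ → ℝ≥0∞ := fun o => o.elim
    (fun x => ENNReal.ofReal (exp (-(N / 2 * x))))
    fun k x => ENNReal.ofReal (|besselSeries 1 (α k * x)| ^ (N / α k))
  have hcont := continuous_besselSeries 1
  have hw0 : ∀ o, 0 ≤ w o := by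
    rintro (_ | k)
    · change 0 ≤ 2 * c / N
      positivity
    · exact div_nonneg (hα k) hN0.le
  have hw1 : ∑ o, w o = 1 := by
    rw [Fintype.sum_option]
    change 2 * c / N + ∑ k, α k / N = 1
    rw [← Finset.sum_div, ← add_div, add_comm, ← hN, div_self hN0.ne']
  have hFm : ∀ o, Measurable (F o) := by
    rintro (_ | k)
    · exact Measurable.ennreal_ofReal (by fun_prop)
    · refine Measurable.ennreal_ofReal (Measurable.pow_const ?_ _)
      fun_prop
  have hFI : ∀ o, (∫⁻ x in Ioi 0, F o x) ^ w o ≤ ENNReal.ofReal (2 / N) ^ w o := by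
    rintro (_ | k)
    · refine ENNReal.rpow_le_rpow ?_ (hw0 _)
      change ∫⁻ x in Ioi 0, ENNReal.ofReal (exp (-(N / 2 * x))) ≤ _
      have hN2 : 0 < N / 2 := by positivity
      have hi := integrableOn_pow_mul_exp_neg_mul 0 hN2
      have hv := integral_pow_mul_exp_neg_mul 0 hN2
      simp only [pow_zero, one_mul] at hi hv
      rw [← ofReal_integral_eq_lintegral_ofReal hi (ae_of_all _ fun x => (Real.exp_pos _).le), hv]
      simp
    · rcases (hα k).eq_or_lt with hk | hk
      · have : w (some k) = 0 := by
          change α k / N = 0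
          rw [← hk, zero_div]
        rw [this, ENNReal.rpow_zero, ENNReal.rpow_zero]
      refine ENNReal.rpow_le_rpow ?_ (hw0 _)
      change ∫⁻ x in Ioi 0, ENNReal.ofReal (|besselSeries 1 (α k * x)| ^ (N / α k)) ≤ _
      have hs : 2 ≤ N / α k := by
        rw [le_div_iff₀ hk]
        exact h k
      have hm : Measurable fun x => ENNReal.ofReal (|besselSeries 1 x| ^ (N / α k)) := by
        refine Measurable.ennreal_ofReal (Measurable.pow_const ?_ _)
        fun_prop
      rw [setLIntegral_Ioi_comp_mul_left hm hk]
      refine (mul_le_mul_right (setLIntegral_Ioi_besselSeries_one_rpow_le hs) _).trans ?_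
      rw [← ENNReal.ofReal_mul (inv_pos.2 hk).le]
      apply ENNReal.ofReal_le_ofReal
      apply le_of_eq
      field_simp
  have hprod : ∀ x, ∏ o, F o x ^ w o
      = ENNReal.ofReal (|∏ k, besselSeries 1 (α k * x)| * exp (-(c * x))) := by
    intro x
    rw [Fintype.prod_option, mul_comm, Finset.abs_prod,
      ENNReal.ofReal_mul (Finset.prod_nonneg fun _ _ => abs_nonneg _),
      ENNReal.ofReal_prod_of_nonneg fun _ _ => abs_nonneg _]
    congr 1
    · refine Finset.prod_congr rfl fun k _ => ?_
      change ENNReal.ofReal (|besselSeries 1 (α k * x)| ^ (N / α k)) ^ (α k / N) = _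
      rcases (hα k).eq_or_lt with hk | hk
      · simp [← hk, besselSeries_zero]
      · rw [ENNReal.ofReal_rpow_of_nonneg (by positivity) (by positivity), ← Real.rpow_mul
          (abs_nonneg _), div_mul_div_cancel₀ hk.ne', div_self hN0.ne', Real.rpow_one]
    · change ENNReal.ofReal (exp (-(N / 2 * x))) ^ (2 * c / N) = _
      rw [ENNReal.ofReal_rpow_of_nonneg (by positivity) (by positivity), ← Real.exp_mul]
      congr 2
      field_simp
  calc _ = ∫⁻ x in Ioi 0, ∏ o, F o x ^ w o := by simp only [hprod]
    _ ≤ ∏ o, (∫⁻ x in Ioi 0, F o x) ^ w o :=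
        ENNReal.lintegral_prod_norm_pow_le _ (fun o _ => (hFm o).aemeasurable) hw1
          fun o _ => hw0 o
    _ ≤ ∏ o, ENNReal.ofReal (2 / N) ^ w o := Finset.prod_le_prod' fun o _ => hFI o
    _ = ENNReal.ofReal (2 / N) := by
        have h2N : 0 < 2 / N := by positivity
        simp only [ENNReal.ofReal_rpow_of_pos h2N]
        rw [← ENNReal.ofReal_prod_of_nonneg fun o _ => by positivity,
          ← Real.rpow_sum_of_nonneg h2N.le fun o _ => hw0 o, hw1, Real.rpow_one]

/-- Both sides are the sum of `(-v)ᵏ Λ^(k+1) / (k+1)!`. -/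
lemma integral_besselSeries_one_mul_exp_neg {v c : ℝ} (hc : 0 < c) :
    ∫ x in Ioi (0 : ℝ), besselSeries 1 (v * x) * exp (-(c * x))
      = ∫ l in (0 : ℝ)..c⁻¹, exp (-(l * v)) := by
  have hterm : ∀ (u : ℝ) (k : ℕ), ∫ x in Ioi (0 : ℝ),
      u ^ k / ((k.factorial : ℝ) * (k + 1).factorial) * (x ^ k * exp (-(c * x)))
      = u ^ k / (k + 1).factorial / c ^ (k + 1) := by
    intro u k
    rw [integral_const_mul, integral_pow_mul_exp_neg_mul k hc]
    have : (k.factorial : ℝ) ≠ 0 := by exact_mod_cast k.factorial_ne_zero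
    field_simp
  have hsum : ∀ u : ℝ, Summable fun k : ℕ => u ^ k / (k + 1).factorial / c ^ (k + 1) := by
    intro u
    refine Summable.of_norm_bounded
      ((Real.summable_pow_div_factorial (|u| / c)).mul_left c⁻¹) fun k => ?_
    rw [norm_div, norm_div, norm_pow, norm_pow, Real.norm_of_nonneg hc.le, Real.norm_natCast,
      Real.norm_eq_abs, div_pow, pow_succ]
    have h1 : (k.factorial : ℝ) ≤ (k + 1).factorial := by
      exact_mod_cast Nat.factorial_le (Nat.le_succ k)
    have h2 : (0 : ℝ) < k.factorial := by exact_mod_cast k.factorial_pos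
    calc |u| ^ k / (k + 1).factorial / (c ^ k * c) ≤ |u| ^ k / k.factorial / (c ^ k * c) := by
          gcongr
      _ = _ := by field_simp
  have hI := hasSum_integral_of_summable_integral_norm (μ := volume.restrict (Ioi (0 : ℝ)))
    (F := fun (k : ℕ) x => (-v) ^ k / ((k.factorial : ℝ) * (k + 1).factorial)
      * (x ^ k * exp (-(c * x))))
    (fun k => (integrableOn_pow_mul_exp_neg_mul k hc).const_mul _) (by
      refine (hsum |v|).congr fun k => ?_
      rw [← hterm]
      refine setIntegral_congr_fun measurableSet_Ioi fun x hx => ?_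
      have hx0 : 0 < x := hx
      have : 0 ≤ x ^ k * exp (-(c * x)) := by positivity
      simp only [norm_mul, norm_div, norm_pow, norm_neg, Real.norm_eq_abs, Nat.abs_cast,
        abs_of_pos hx0, Real.abs_exp])
  simp only [hterm] at hI
  have hL : ∀ x, ∑' k : ℕ, (-v) ^ k / ((k.factorial : ℝ) * (k + 1).factorial)
      * (x ^ k * exp (-(c * x))) = besselSeries 1 (v * x) * exp (-(c * x)) := by
    intro x
    rw [besselSeries, ← tsum_mul_right]
    refine tsum_congr fun k => ?_
    rw [← neg_mul v x, mul_pow]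
    ring
  simp only [hL] at hI
  rw [← hI.tsum_eq]
  rcases eq_or_ne v 0 with rfl | hv
  · rw [tsum_eq_single 0]
    · simp
    · intro k hk
      simp [hk]
  · have hv' : -v ≠ 0 := neg_ne_zero.2 hv
    have e1 : ∫ l in (0 : ℝ)..c⁻¹, exp (-(l * v)) = (-v)⁻¹ * (exp (-v * c⁻¹) - 1) := by
      have := intervalIntegral.integral_comp_mul_left (a := 0) (b := c⁻¹) (fun x => exp x) hv'
      rw [integral_exp] at this
      simp only [mul_zero, Real.exp_zero, smul_eq_mul] at this
      rw [← this]
      refine intervalIntegral.integral_congr fun x _ => ?_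
      ring_nf
    rw [e1]
    have he : HasSum (fun k : ℕ => (-v * c⁻¹) ^ k / k.factorial) (exp (-v * c⁻¹)) := by
      rw [Real.exp_eq_exp_ℝ]
      exact NormedSpace.expSeries_div_hasSum_exp _
    rw [← hasSum_nat_add_iff' 1] at he
    simp only [Finset.sum_range_one, pow_zero, Nat.factorial_zero, Nat.cast_one, div_one] at he
    have he' := he.mul_left (-v)⁻¹
    rw [← he'.tsum_eq]
    refine tsum_congr fun k => ?_
    rw [mul_pow, pow_succ (-v), inv_pow]
    field_simp

namespace IsUniformOnSphere

variable {d : ℕ} {μ : Measure (EuclideanSpace ℝ (Fin d))}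

lemma ae_norm_eq_one (hμ : IsUniformOnSphere μ) : ∀ᵐ x ∂μ, ‖x‖ = 1 := by
  have : ∀ᵐ x ∂μ, x ∈ Metric.sphere (0 : EuclideanSpace ℝ (Fin d)) 1 := hμ.1
  simpa using this

lemma integrable_of_continuous [IsFiniteMeasure μ] (hμ : IsUniformOnSphere μ)
    {F : Type*} [NormedAddCommGroup F] {g : EuclideanSpace ℝ (Fin d) → F} (hg : Continuous g) :
    Integrable g μ := by
  have h : μ.restrict (Metric.sphere 0 1) = μ := Measure.restrict_eq_self_of_ae_mem hμ.1
  rw [← h]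
  exact hg.continuousOn.integrableOn_compact (isCompact_sphere 0 1)

lemma exists_map_eq {v w : EuclideanSpace ℝ (Fin d)} (h : ‖v‖ = ‖w‖) :
    ∃ Q : EuclideanSpace ℝ (Fin d) ≃ₗᵢ[ℝ] EuclideanSpace ℝ (Fin d), Q v = w :=
  ⟨(ℝ ∙ (v - w))ᗮ.reflection, Submodule.reflection_sub h⟩

lemma map_inner_eq (hμ : IsUniformOnSphere μ) {v w : EuclideanSpace ℝ (Fin d)}
    (h : ‖v‖ = ‖w‖) : μ.map (fun x => inner ℝ x v) = μ.map fun x => inner ℝ x w := by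
  obtain ⟨Q, rfl⟩ := exists_map_eq h
  conv_rhs => rw [← hμ.2 Q]
  rw [Measure.map_map (by fun_prop) (by fun_prop)]
  congr 1
  funext x
  simp

lemma integral_inner_eq (hμ : IsUniformOnSphere μ) {v w : EuclideanSpace ℝ (Fin d)}
    (h : ‖v‖ = ‖w‖) {F : Type*} [NormedAddCommGroup F] [NormedSpace ℝ F] {g : ℝ → F}
    (hg : Continuous g) :
    ∫ x, g (inner ℝ x v) ∂μ = ∫ x, g (inner ℝ x w) ∂μ := by
  have key : ∀ u : EuclideanSpace ℝ (Fin d),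
      ∫ x, g (inner ℝ x u) ∂μ = ∫ y, g y ∂(μ.map fun x => inner ℝ x u) := fun u =>
    (integral_map (φ := fun x : EuclideanSpace ℝ (Fin d) => inner ℝ x u)
      (Measurable.aemeasurable (by fun_prop)) hg.stronglyMeasurable.aestronglyMeasurable).symm
  rw [key, key, hμ.map_inner_eq h]

lemma lintegral_inner_eq (hμ : IsUniformOnSphere μ) {v w : EuclideanSpace ℝ (Fin d)}
    (h : ‖v‖ = ‖w‖) {g : ℝ → ℝ≥0∞} (hg : Measurable g) :
    ∫⁻ x, g (inner ℝ x v) ∂μ = ∫⁻ x, g (inner ℝ x w) ∂μ := by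
  have key : ∀ u : EuclideanSpace ℝ (Fin d),
      ∫⁻ x, g (inner ℝ x u) ∂μ = ∫⁻ y, g y ∂(μ.map fun x => inner ℝ x u) := fun u =>
    (lintegral_map hg (by fun_prop)).symm
  rw [key, key, hμ.map_inner_eq h]

lemma integral_inner_pow [IsProbabilityMeasure μ] [NeZero d] (hμ : IsUniformOnSphere μ)
    (v : EuclideanSpace ℝ (Fin d)) (n : ℕ) :
    ∫ x, (inner ℝ x v) ^ n ∂μ = ‖v‖ ^ n * ∫ x, (x 0) ^ n ∂μ := by
  have h : ‖v‖ = ‖EuclideanSpace.single (0 : Fin d) ‖v‖‖ := by simp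
  rw [hμ.integral_inner_eq h (continuous_pow n), ← integral_const_mul]
  refine integral_congr_ae (ae_of_all _ fun x => ?_)
  simp [EuclideanSpace.inner_single_right, mul_pow]

lemma integral_pow_mul_sq [IsProbabilityMeasure μ] [NeZero d] (hμ : IsUniformOnSphere μ)
    (j : Fin d) (hj : j ≠ 0) (k : ℕ) :
    (2 * k + 1) * ∫ x, (x 0) ^ (2 * k) * (x j) ^ 2 ∂μ = ∫ x, (x 0) ^ (2 * k + 2) ∂μ := by
  set m := ∫ x, (x 0) ^ (2 * k + 2) ∂μ with hm
  let P : Polynomial ℝ := ∑ i ∈ Finset.range (2 * k + 3),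
    Polynomial.C ((∫ x, (x 0) ^ (2 * k + 2 - i) * (x j) ^ i ∂μ) * (2 * k + 2).choose i)
      * Polynomial.X ^ i
  let R : Polynomial ℝ := Polynomial.C m * Polynomial.expand ℝ 2 ((1 + Polynomial.X) ^ (k + 1))
  have hPR : P = R := by
    refine Polynomial.funext fun s => ?_
    have h := hμ.integral_inner_pow
      (EuclideanSpace.single j s + EuclideanSpace.single (0 : Fin d) (1 : ℝ)) (2 * k + 2)
    have hn : ‖EuclideanSpace.single j s + EuclideanSpace.single (0 : Fin d) (1 : ℝ)‖ ^ 2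
        = 1 + s ^ 2 := by
      rw [norm_add_sq_real]
      simp [EuclideanSpace.inner_single_left, hj.symm]
      ring
    rw [show 2 * k + 2 = 2 * (k + 1) by ring, pow_mul ‖_‖, hn] at h
    have hR : R.eval s = m * (1 + s ^ 2) ^ (k + 1) := by
      simp [R]
    have hP : P.eval s = ∫ x, (inner ℝ x
        (EuclideanSpace.single j s + EuclideanSpace.single (0 : Fin d) (1 : ℝ)))
          ^ (2 * (k + 1)) ∂μ := by
      simp only [inner_add_right, EuclideanSpace.inner_single_right, conj_trivial,
        add_pow]
      rw [integral_finsetSum]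
      · simp only [P, Polynomial.eval_finsetSum, Polynomial.eval_mul, Polynomial.eval_C,
          Polynomial.eval_pow, Polynomial.eval_X]
        refine Finset.sum_congr (by ring_nf) fun i _ => ?_
        rw [mul_assoc, ← integral_mul_const]
        refine integral_congr_ae (ae_of_all _ fun x => ?_)
        simp [mul_pow]
        ring_nf
      · intro i _
        exact hμ.integrable_of_continuous (by fun_prop)
    rw [hP, h, hR, hm]
    ring_nf
  have hc := congrArg (fun q : Polynomial ℝ => q.coeff 2) hPR
  simp only [P, R, Polynomial.finsetSum_coeff, Polynomial.coeff_C_mul, Polynomial.coeff_X_pow,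
    Polynomial.coeff_expand two_pos, Polynomial.coeff_one_add_X_pow] at hc
  have hch : (((2 * k + 2).choose 2 : ℕ) : ℝ) = (2 * k + 1) * (k + 1) := by
    rw [Nat.cast_choose_two]
    push_cast
    ring
  simp [hch] at hc
  have hk : (k : ℝ) + 1 ≠ 0 := by positivity
  apply mul_right_cancel₀ hk
  linarith

lemma integral_pow_add_two {μ : Measure (EuclideanSpace ℝ (Fin 4))} [IsProbabilityMeasure μ]
    (hμ : IsUniformOnSphere μ) (k : ℕ) :
    (2 * k + 4) * ∫ x, (x 0) ^ (2 * (k + 1)) ∂μ = (2 * k + 1) * ∫ x, (x 0) ^ (2 * k) ∂μ := by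
  have h : ∫ x, (x 0) ^ (2 * k) ∂μ
      = ∫ x, ∑ j : Fin 4, (x 0) ^ (2 * k) * (x j) ^ 2 ∂μ := by
    refine integral_congr_ae ?_
    filter_upwards [hμ.ae_norm_eq_one] with x hx
    rw [← Finset.mul_sum]
    have : ∑ j, x j ^ 2 = 1 := by
      have := EuclideanSpace.norm_sq_eq x
      rw [hx] at this
      simpa using this.symm
    rw [this, mul_one]
  rw [integral_finsetSum _ fun i _ => hμ.integrable_of_continuous (by fun_prop)] at h
  have h0 : ∀ x : EuclideanSpace ℝ (Fin 4), (x 0) ^ (2 * k) * (x 0) ^ 2 = (x 0) ^ (2 * k + 2) :=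
    fun x => (pow_add _ _ _).symm
  have h1 := hμ.integral_pow_mul_sq 1 (by decide) k
  have h2 := hμ.integral_pow_mul_sq 2 (by decide) k
  have h3 := hμ.integral_pow_mul_sq 3 (by decide) k
  rw [h, Fin.sum_univ_four, show 2 * (k + 1) = 2 * k + 2 by ring]
  simp only [h0]
  linear_combination -h1 - h2 - h3

variable {μ : Measure (EuclideanSpace ℝ (Fin 4))} [IsProbabilityMeasure μ]

lemma integral_pow_two_mul (hμ : IsUniformOnSphere μ) (k : ℕ) :
    (∫ x, (x 0) ^ (2 * k) ∂μ) / (2 * k).factorial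
      = 1 / (4 ^ k * (k.factorial * (k + 1).factorial)) := by
  induction k with
  | zero => simp
  | succ k ih =>
    have h := hμ.integral_pow_add_two k
    have e1 : ((2 * (k + 1)).factorial : ℝ) = (2 * k + 2) * ((2 * k + 1) * (2 * k).factorial) := by
      rw [show 2 * (k + 1) = 2 * k + 1 + 1 by ring, Nat.factorial_succ, Nat.factorial_succ]
      push_cast
      ring
    have e2 : ((k + 1 + 1).factorial : ℝ) = (k + 2) * (k + 1).factorial := by
      rw [Nat.factorial_succ (k + 1)]
      push_cast
      ring
    have e3 : ((k + 1).factorial : ℝ) = (k + 1) * k.factorial := by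
      rw [Nat.factorial_succ k]
      push_cast
      ring
    have p1 : ((2 * k).factorial : ℝ) ≠ 0 := by exact_mod_cast Nat.factorial_ne_zero _
    have p2 : (k.factorial : ℝ) ≠ 0 := by exact_mod_cast Nat.factorial_ne_zero _
    have p3 : (2 * (k : ℝ) + 4) ≠ 0 := by positivity
    have p4 : (2 * (k : ℝ) + 1) ≠ 0 := by positivity
    have h' : ∫ x, (x 0) ^ (2 * (k + 1)) ∂μ
        = (2 * k + 1) / (2 * k + 4) * ∫ x, (x 0) ^ (2 * k) ∂μ := by
      rw [div_mul_eq_mul_div, eq_div_iff p3, ← h, mul_comm]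
    have ih' : ∫ x, (x 0) ^ (2 * k) ∂μ = (2 * k).factorial
        / (4 ^ k * (k.factorial * (k + 1).factorial)) := by
      rw [div_eq_iff p1] at ih
      rw [ih]
      ring
    rw [h', ih', e1, e2, e3]
    field_simp
    ring

lemma integral_cos_inner (hμ : IsUniformOnSphere μ) (v : EuclideanSpace ℝ (Fin 4)) :
    ∫ x, cos (inner ℝ x v) ∂μ = besselSeries 1 (‖v‖ ^ 2 / 4) := by
  have hterm : ∀ k : ℕ, ∫ x, (inner ℝ x v) ^ (2 * k) / ((2 * k).factorial : ℝ) ∂μ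
      = (‖v‖ ^ 2 / 4) ^ k / (k.factorial * (k + 1).factorial) := by
    intro k
    rw [integral_div, hμ.integral_inner_pow, mul_div_assoc, hμ.integral_pow_two_mul, div_pow,
      pow_mul]
    field_simp
  have hI := hasSum_integral_of_summable_integral_norm (μ := μ)
    (F := fun (k : ℕ) x => (-1) ^ k * (inner ℝ x v) ^ (2 * k) / ((2 * k).factorial : ℝ))
    (fun k => hμ.integrable_of_continuous (by fun_prop)) (by
      have := (summable_besselSeries 1 (-(‖v‖ ^ 2 / 4)))
      refine this.congr fun k => ?_
      rw [neg_neg, ← hterm]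
      refine integral_congr_ae (ae_of_all _ fun x => ?_)
      simp [pow_mul])
  have hcos : ∀ x, ∑' k : ℕ, (-1) ^ k * (inner ℝ x v) ^ (2 * k) / ((2 * k).factorial : ℝ)
      = cos (inner ℝ x v) := fun x => (Real.hasSum_cos _).tsum_eq
  simp only [hcos] at hI
  rw [← hI.tsum_eq, besselSeries]
  refine tsum_congr fun k => ?_
  simp only [mul_div_assoc]
  rw [integral_const_mul, hterm, neg_pow (‖v‖ ^ 2 / 4), mul_div_assoc]

lemma integral_cexp_inner (hμ : IsUniformOnSphere μ) (v : EuclideanSpace ℝ (Fin 4)) :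
    ∫ x, Complex.exp ((inner ℝ x v : ℝ) * Complex.I) ∂μ = besselSeries 1 (‖v‖ ^ 2 / 4) := by
  have hsin : ∫ x, sin (inner ℝ x v) ∂μ = 0 := by
    have h := hμ.integral_inner_eq (norm_neg v).symm continuous_sin
    simp only [inner_neg_right, sin_neg, integral_neg] at h
    linarith
  have hexp : ∀ x : EuclideanSpace ℝ (Fin 4), Complex.exp ((inner ℝ x v : ℝ) * Complex.I)
      = (cos (inner ℝ x v) : ℝ) + (sin (inner ℝ x v) : ℝ) * Complex.I := by
    intro x
    rw [Complex.exp_mul_I]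
    push_cast
    rfl
  simp only [hexp]
  rw [integral_add, integral_mul_const, integral_complex_ofReal,
    integral_complex_ofReal, hsin,
    hμ.integral_cos_inner]
  · simp
  · exact hμ.integrable_of_continuous (by fun_prop)
  · exact hμ.integrable_of_continuous (by fun_prop)

/-- Averaging the characteristic function of the sphere over the sum of independent vectors. -/
lemma integral_besselSeries_one_norm_sum (hμ : IsUniformOnSphere μ) {n : ℕ} (a : Fin n → ℝ)
    {t : ℝ} (ht : 0 ≤ t) :
    ∫ x, besselSeries 1 (‖∑ k, a k • x k‖ ^ 2 * t) ∂(Measure.pi fun _ : Fin n => μ)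
      = ∏ k, besselSeries 1 (a k ^ 2 * t) := by
  set P := Measure.pi fun _ : Fin n => μ
  have hr : √t ^ 2 = t := Real.sq_sqrt ht
  have e1 : ∀ x : Fin n → EuclideanSpace ℝ (Fin 4),
      ((besselSeries 1 (‖∑ k, a k • x k‖ ^ 2 * t) : ℝ) : ℂ)
      = ∫ y, Complex.exp ((inner ℝ y ((2 * √t) • ∑ k, a k • x k) : ℝ) * Complex.I) ∂μ := by
    intro x
    rw [hμ.integral_cexp_inner, norm_smul, mul_pow, Real.norm_eq_abs, sq_abs, mul_pow, hr]
    congr 2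
    ring
  have e2 : ∀ y : EuclideanSpace ℝ (Fin 4), ‖y‖ = 1 →
      ∫ x, Complex.exp ((inner ℝ y ((2 * √t) • ∑ k, a k • x k) : ℝ) * Complex.I) ∂P
      = ((∏ k, besselSeries 1 (a k ^ 2 * t) : ℝ) : ℂ) := by
    intro y hy
    have : ∀ x : Fin n → EuclideanSpace ℝ (Fin 4),
        Complex.exp ((inner ℝ y ((2 * √t) • ∑ k, a k • x k) : ℝ) * Complex.I)
        = ∏ k, Complex.exp ((inner ℝ (x k) ((2 * √t * a k) • y) : ℝ) * Complex.I) := by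
      intro x
      rw [← Complex.exp_sum, ← Finset.sum_mul, ← Complex.ofReal_sum]
      congr 3
      rw [inner_smul_right, inner_sum, Finset.mul_sum]
      refine Finset.sum_congr rfl fun k _ => ?_
      rw [inner_smul_right, inner_smul_right, real_inner_comm]
      ring
    simp only [this]
    rw [integral_fintype_prod_eq_prod
      (f := fun k z => Complex.exp ((inner ℝ z ((2 * √t * a k) • y) : ℝ) * Complex.I))]
    push_cast
    refine Finset.prod_congr rfl fun k _ => ?_
    rw [hμ.integral_cexp_inner, norm_smul, hy, Real.norm_eq_abs, mul_one, sq_abs, mul_pow,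
      mul_pow, hr]
    congr 2
    ring
  have e3 : ((∫ x, besselSeries 1 (‖∑ k, a k • x k‖ ^ 2 * t) ∂P : ℝ) : ℂ)
      = ((∏ k, besselSeries 1 (a k ^ 2 * t) : ℝ) : ℂ) := by
    rw [← integral_complex_ofReal]
    simp only [e1]
    rw [integral_integral_swap]
    · rw [integral_congr_ae (g := fun _ => ((∏ k, besselSeries 1 (a k ^ 2 * t) : ℝ) : ℂ))]
      · simp
      · filter_upwards [hμ.ae_norm_eq_one] with y hy using e2 y hy
    · refine Integrable.of_bound (C := 1) (Continuous.aestronglyMeasurable ?_)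
        (ae_of_all _ fun z => ?_)
      · unfold Function.uncurry
        fun_prop
      · simp only [Function.uncurry]
        rw [Complex.norm_exp_ofReal_mul_I]
  exact_mod_cast e3

end IsUniformOnSphere

lemma sum_catalan_mul_pow_le {u : ℝ} (hu : 0 ≤ u) (K : ℕ) :
    ∑ k ∈ Finset.range K, (catalan k : ℝ) * (u / (1 + u) ^ 2) ^ k ≤ 1 + u := by
  set z := u / (1 + u) ^ 2 with hz
  have hz0 : 0 ≤ z := by positivity
  induction K with
  | zero => simp; positivity
  | succ K ih =>
    have hconv : ∑ k ∈ Finset.range K, (catalan (k + 1) : ℝ) * z ^ k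
        ≤ (∑ k ∈ Finset.range K, (catalan k : ℝ) * z ^ k) ^ 2 := by
      have h1 : ∀ k ∈ Finset.range K, (catalan (k + 1) : ℝ) * z ^ k
          = ∑ p ∈ Finset.HasAntidiagonal.antidiagonal k,
            ((catalan p.1 : ℝ) * z ^ p.1) * ((catalan p.2 : ℝ) * z ^ p.2) := by
        intro k _
        rw [catalan_succ', Nat.cast_sum, Finset.sum_mul]
        refine Finset.sum_congr rfl fun p hp => ?_
        rw [← Finset.HasAntidiagonal.mem_antidiagonal.1 hp]
        push_cast
        ring
      rw [Finset.sum_congr rfl h1, ← Finset.sum_biUnion, sq, Finset.sum_mul_sum,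
        ← Finset.sum_product']
      · refine Finset.sum_le_sum_of_subset_of_nonneg ?_ fun p _ _ => by positivity
        intro p hp
        simp only [Finset.mem_biUnion, Finset.mem_range,
          Finset.HasAntidiagonal.mem_antidiagonal] at hp
        simp only [Finset.mem_product, Finset.mem_range]
        obtain ⟨k, hk, hpk⟩ := hp
        omega
      · intro k _ l _ hkl
        refine Finset.disjoint_left.2 fun p hp hp' => hkl ?_
        rw [← Finset.HasAntidiagonal.mem_antidiagonal.1 hp,
          ← Finset.HasAntidiagonal.mem_antidiagonal.1 hp']
    rw [Finset.sum_range_succ']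
    have h2 : ∑ k ∈ Finset.range K, (catalan (k + 1) : ℝ) * z ^ (k + 1)
        = z * ∑ k ∈ Finset.range K, (catalan (k + 1) : ℝ) * z ^ k := by
      rw [Finset.mul_sum]
      exact Finset.sum_congr rfl fun k _ => by ring
    rw [h2]
    have h0 : 0 ≤ ∑ k ∈ Finset.range K, (catalan k : ℝ) * z ^ k :=
      Finset.sum_nonneg fun k _ => by positivity
    have h3 : z * ∑ k ∈ Finset.range K, (catalan (k + 1) : ℝ) * z ^ k ≤ z * (1 + u) ^ 2 :=
      mul_le_mul_of_nonneg_left (hconv.trans (by gcongr)) hz0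
    have h4 : z * (1 + u) ^ 2 = u := by
      rw [hz]
      field_simp
    simp
    linarith

lemma catalan_eq_factorial_div (k : ℕ) :
    (catalan k : ℝ) = (2 * k).factorial / (k.factorial * (k + 1).factorial) := by
  have h1 := succ_mul_catalan_eq_centralBinom k
  have h2 := Nat.choose_mul_factorial_mul_factorial (show k ≤ 2 * k by omega)
  rw [← Nat.centralBinom_eq_two_mul_choose, ← h1, show 2 * k - k = k by omega] at h2
  have p : (k.factorial * (k + 1).factorial : ℝ) ≠ 0 := by
    exact_mod_cast mul_ne_zero (Nat.factorial_ne_zero _) (Nat.factorial_ne_zero _)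
  rw [eq_div_iff p, ← h2, Nat.factorial_succ]
  push_cast
  ring

lemma inv_add_inv_le_geometric {w : ℝ} (hw : |w| ≤ 1) :
    (ENNReal.ofReal (1 + w))⁻¹ + (ENNReal.ofReal (1 - w))⁻¹
      ≤ 2 * ∑' k : ℕ, ENNReal.ofReal (w ^ (2 * k)) := by
  have hsq : 0 ≤ w ^ 2 := sq_nonneg w
  have hgeo : ∑' k : ℕ, ENNReal.ofReal (w ^ (2 * k)) = (ENNReal.ofReal (1 - w ^ 2))⁻¹ := by
    rw [ENNReal.ofReal_sub _ hsq, ENNReal.ofReal_one, ← ENNReal.tsum_geometric]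
    exact tsum_congr fun k => by rw [pow_mul, ENNReal.ofReal_pow hsq]
  rw [hgeo]
  rcases hw.lt_or_eq with h | h
  · obtain ⟨h1, h2⟩ := abs_lt.1 h
    have p1 : 0 < 1 + w := by linarith
    have p2 : 0 < 1 - w := by linarith
    have p3 : 0 < 1 - w ^ 2 := by nlinarith
    rw [← ENNReal.ofReal_inv_of_pos p1, ← ENNReal.ofReal_inv_of_pos p2,
      ← ENNReal.ofReal_inv_of_pos p3, ← ENNReal.ofReal_add (by positivity) (by positivity),
      ← ENNReal.ofReal_ofNat 2, ← ENNReal.ofReal_mul (by norm_num)]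
    apply ENNReal.ofReal_le_ofReal
    apply le_of_eq
    have : 1 - w ^ 2 = (1 + w) * (1 - w) := by ring
    rw [this]
    field_simp
    ring
  · have : 1 - w ^ 2 = 0 := by rw [← sq_abs, h]; norm_num
    rw [this]
    simp

namespace IsUniformOnSphere

variable {μ : Measure (EuclideanSpace ℝ (Fin 4))} [IsProbabilityMeasure μ]

lemma integral_inner_pow_two_mul (hμ : IsUniformOnSphere μ) (v : EuclideanSpace ℝ (Fin 4))
    (k : ℕ) : ∫ x, (inner ℝ x v) ^ (2 * k) ∂μ = catalan k * (‖v‖ ^ 2 / 4) ^ k := by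
  have h := hμ.integral_pow_two_mul k
  have p : ((2 * k).factorial : ℝ) ≠ 0 := by exact_mod_cast Nat.factorial_ne_zero _
  rw [div_eq_iff p] at h
  rw [hμ.integral_inner_pow, h, catalan_eq_factorial_div, div_pow, pow_mul]
  field_simp

/-- A form of the superharmonicity of `‖·‖⁻²` in dimension four. -/
lemma lintegral_inv_norm_sq_smul_add_le (hμ : IsUniformOnSphere μ) {a : ℝ} (ha : a ≠ 0)
    (y : EuclideanSpace ℝ (Fin 4)) :
    ∫⁻ x, (ENNReal.ofReal (‖a • x + y‖ ^ 2))⁻¹ ∂μ ≤ ENNReal.ofReal (a ^ 2)⁻¹ := by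
  have ha2 : 0 < a ^ 2 := by positivity
  set A := a ^ 2 + ‖y‖ ^ 2 with hA
  have hA0 : 0 < A := by positivity
  set v : EuclideanSpace ℝ (Fin 4) := (2 * a / A) • y with hv
  set u := ‖y‖ ^ 2 / a ^ 2 with hu
  have hu0 : 0 ≤ u := by positivity
  have hvz : ‖v‖ ^ 2 / 4 = u / (1 + u) ^ 2 := by
    rw [hv, norm_smul, mul_pow, Real.norm_eq_abs, sq_abs, hu, hA]
    field_simp
    ring
  have hv1 : ‖v‖ ≤ 1 := by
    have : ‖v‖ ^ 2 ≤ 1 := by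
      have : u / (1 + u) ^ 2 ≤ 1 / 4 := by
        rw [div_le_iff₀ (by positivity)]
        nlinarith [sq_nonneg (1 - u)]
      linarith
    nlinarith [norm_nonneg v]
  have hAm : (ENNReal.ofReal A)⁻¹ ≠ ⊤ := by simpa using hA0
  have e1 : ∫⁻ x, (ENNReal.ofReal (‖a • x + y‖ ^ 2))⁻¹ ∂μ
      = (ENNReal.ofReal A)⁻¹ * ∫⁻ x, (ENNReal.ofReal (1 + inner ℝ x v))⁻¹ ∂μ := by
    rw [← lintegral_const_mul' _ _ hAm]
    refine lintegral_congr_ae ?_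
    filter_upwards [hμ.ae_norm_eq_one] with x hx
    rw [← ENNReal.mul_inv (by simp) (by simp), ← ENNReal.ofReal_mul hA0.le]
    congr 2
    rw [norm_add_sq_real, norm_smul, hx, hv, inner_smul_right, inner_smul_left, mul_one,
      Real.norm_eq_abs, sq_abs, hA]
    simp only [conj_trivial]
    field_simp
    ring
  have e2 : ∫⁻ x, (ENNReal.ofReal (1 + inner ℝ x v))⁻¹ ∂μ
      = ∫⁻ x, (ENNReal.ofReal (1 - inner ℝ x v))⁻¹ ∂μ := by
    have := hμ.lintegral_inner_eq (norm_neg v).symm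
      (g := fun t => (ENNReal.ofReal (1 + t))⁻¹) (by fun_prop)
    simpa [← sub_eq_add_neg] using this
  have e3 : 2 * ∫⁻ x, (ENNReal.ofReal (1 + inner ℝ x v))⁻¹ ∂μ
      ≤ 2 * ∑' k : ℕ, ENNReal.ofReal (catalan k * (u / (1 + u) ^ 2) ^ k) := by
    calc 2 * ∫⁻ x, (ENNReal.ofReal (1 + inner ℝ x v))⁻¹ ∂μ
        = ∫⁻ x, ((ENNReal.ofReal (1 + inner ℝ x v))⁻¹
            + (ENNReal.ofReal (1 - inner ℝ x v))⁻¹) ∂μ := by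
          rw [lintegral_add_left (by fun_prop), ← e2, two_mul]
      _ ≤ ∫⁻ x, 2 * ∑' k : ℕ, ENNReal.ofReal ((inner ℝ x v) ^ (2 * k)) ∂μ := by
          refine lintegral_mono_ae ?_
          filter_upwards [hμ.ae_norm_eq_one] with x hx
          refine inv_add_inv_le_geometric ((abs_real_inner_le_norm x v).trans ?_)
          rw [hx, one_mul]
          exact hv1
      _ = _ := by
          rw [lintegral_const_mul' _ _ (by simp), lintegral_tsum fun k => by fun_prop]
          congr 1
          refine tsum_congr fun k => ?_
          rw [← ofReal_integral_eq_lintegral_ofReal (hμ.integrable_of_continuous (by fun_prop)),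
            hμ.integral_inner_pow_two_mul, hvz]
          exact ae_of_all _ fun x => by simp only [pow_mul, Pi.zero_apply]; positivity
  have e4 : ∑' k : ℕ, ENNReal.ofReal (catalan k * (u / (1 + u) ^ 2) ^ k)
      ≤ ENNReal.ofReal (1 + u) := by
    rw [ENNReal.tsum_eq_iSup_nat]
    refine iSup_le fun K => ?_
    rw [← ENNReal.ofReal_sum_of_nonneg fun k _ => by positivity]
    exact ENNReal.ofReal_le_ofReal (sum_catalan_mul_pow_le hu0 K)
  have e5 := ((ENNReal.mul_le_mul_iff_right (by simp) (by simp)).1 e3).trans e4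
  rw [e1]
  refine (mul_le_mul_right e5 _).trans (le_of_eq ?_)
  rw [← ENNReal.ofReal_inv_of_pos hA0, ← ENNReal.ofReal_mul (by positivity)]
  congr 1
  rw [hu, hA]
  field_simp

lemma lintegral_inv_norm_sum_sq_le (hμ : IsUniformOnSphere μ) {n : ℕ} (a : Fin n → ℝ)
    (i : Fin n) (hi : a i ≠ 0) :
    ∫⁻ x, (ENNReal.ofReal (‖∑ k, a k • x k‖ ^ 2))⁻¹ ∂(Measure.pi fun _ : Fin n => μ)
      ≤ ENNReal.ofReal (a i ^ 2)⁻¹ := by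
  obtain ⟨m, rfl⟩ : ∃ m, n = m + 1 := ⟨n - 1, by have := i.2; omega⟩
  have hmp := measurePreserving_piFinSuccAbove (fun _ : Fin (m + 1) => μ) i
  have hmeas : Measurable
      (fun z : EuclideanSpace ℝ (Fin 4) × (Fin m → EuclideanSpace ℝ (Fin 4)) =>
        (ENNReal.ofReal (‖a i • z.1 + ∑ j, a (i.succAbove j) • z.2 j‖ ^ 2))⁻¹) := by
    fun_prop
  calc _ = ∫⁻ x, (ENNReal.ofReal (‖a i • x i
            + ∑ j, a (i.succAbove j) • x (i.succAbove j)‖ ^ 2))⁻¹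
          ∂(Measure.pi fun _ : Fin (m + 1) => μ) :=
        lintegral_congr fun x => by rw [Fin.sum_univ_succAbove _ i]
    _ = ∫⁻ z, (ENNReal.ofReal (‖a i • z.1 + ∑ j, a (i.succAbove j) • z.2 j‖ ^ 2))⁻¹
          ∂(μ.prod (Measure.pi fun _ : Fin m => μ)) := hmp.lintegral_comp hmeas
    _ = ∫⁻ y, ∫⁻ x, (ENNReal.ofReal (‖a i • x + ∑ j, a (i.succAbove j) • y j‖ ^ 2))⁻¹ ∂μ
          ∂(Measure.pi fun _ : Fin m => μ) := lintegral_prod_symm _ hmeas.aemeasurable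
    _ ≤ ∫⁻ _, ENNReal.ofReal (a i ^ 2)⁻¹ ∂(Measure.pi fun _ : Fin m => μ) :=
        lintegral_mono fun y => hμ.lintegral_inv_norm_sq_smul_add_le hi _
    _ = _ := by simp

end IsUniformOnSphere

lemma lintegral_Ioi_exp_neg_mul_le (v : ℝ) (hv : 0 ≤ v) :
    ∫⁻ l in Ioi (0 : ℝ), ENNReal.ofReal (exp (-(l * v))) ≤ (ENNReal.ofReal v)⁻¹ := by
  rcases hv.eq_or_lt with rfl | h
  · simp
  · have h1 := integrableOn_pow_mul_exp_neg_mul 0 h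
    have h2 := integral_pow_mul_exp_neg_mul 0 h
    simp only [pow_zero, one_mul, mul_comm v] at h1 h2
    rw [← ofReal_integral_eq_lintegral_ofReal h1 (ae_of_all _ fun x => (exp_pos _).le), h2,
      ← ENNReal.ofReal_inv_of_pos h]
    simp

namespace IsUniformOnSphere

variable {μ : Measure (EuclideanSpace ℝ (Fin 4))} [IsProbabilityMeasure μ]

lemma integral_laplace_norm_sum_sq_eq (hμ : IsUniformOnSphere μ) {n : ℕ} (a : Fin n → ℝ)
    {c : ℝ} (hc : 0 < c) :
    ∫ x, (∫ l in (0 : ℝ)..c⁻¹, exp (-(l * ‖∑ k, a k • x k‖ ^ 2)))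
        ∂(Measure.pi fun _ : Fin n => μ)
      = ∫ t in Ioi (0 : ℝ), (∏ k, besselSeries 1 (a k ^ 2 * t)) * exp (-(c * t)) := by
  have hexp := integrableOn_pow_mul_exp_neg_mul 0 hc
  simp only [pow_zero, one_mul] at hexp
  have hint : Integrable (Function.uncurry fun (x : Fin n → EuclideanSpace ℝ (Fin 4)) (t : ℝ) =>
      besselSeries 1 (‖∑ k, a k • x k‖ ^ 2 * t) * exp (-(c * t)))
      ((Measure.pi fun _ : Fin n => μ).prod (volume.restrict (Ioi 0))) := by
    have hdom : Integrable (fun z : (Fin n → EuclideanSpace ℝ (Fin 4)) × ℝ => exp (-(c * z.2)))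
        ((Measure.pi fun _ : Fin n => μ).prod (volume.restrict (Ioi 0))) := by
      simpa using (integrable_const (1 : ℝ)
        (μ := (Measure.pi fun _ : Fin n => μ))).mul_prod hexp
    refine hdom.mono' ?_ ?_
    · refine Continuous.aestronglyMeasurable ?_
      have := continuous_besselSeries 1
      unfold Function.uncurry
      fun_prop
    · have h0 : ∀ᵐ z ∂((Measure.pi fun _ : Fin n => μ).prod (volume.restrict (Ioi (0 : ℝ)))),
          z.2 ∈ Ioi (0 : ℝ) :=
        Measure.quasiMeasurePreserving_snd.ae (ae_restrict_mem measurableSet_Ioi)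
      filter_upwards [h0] with z hz
      have hz0 : (0 : ℝ) < z.2 := hz
      have := abs_besselSeries_le 1 (x := ‖∑ k, a k • z.1 k‖ ^ 2 * z.2) (by positivity)
      simp only [Function.uncurry, norm_mul, Real.norm_eq_abs, abs_exp]
      refine mul_le_of_le_one_left (exp_pos _).le ?_
      simpa using this
  calc _ = ∫ x, (∫ t in Ioi (0 : ℝ), besselSeries 1 (‖∑ k, a k • x k‖ ^ 2 * t) * exp (-(c * t)))
          ∂(Measure.pi fun _ : Fin n => μ) :=
        integral_congr_ae (ae_of_all _ fun x => (integral_besselSeries_one_mul_exp_neg hc).symm)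
    _ = ∫ t in Ioi (0 : ℝ), (∫ x, besselSeries 1 (‖∑ k, a k • x k‖ ^ 2 * t) * exp (-(c * t))
          ∂(Measure.pi fun _ : Fin n => μ)) := integral_integral_swap hint
    _ = _ := setIntegral_congr_fun measurableSet_Ioi fun t ht => by
        simp only [integral_mul_const]
        rw [hμ.integral_besselSeries_one_norm_sum a (le_of_lt ht)]

lemma setLIntegral_laplace_norm_sum_sq_le (hμ : IsUniformOnSphere μ) {n : ℕ} {a : Fin n → ℝ}
    {T : ℝ} (hT : 0 < T) :
    ∫⁻ l in Ioc 0 T, ∫⁻ x, ENNReal.ofReal (exp (-(l * ‖∑ k, a k • x k‖ ^ 2)))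
        ∂(Measure.pi fun _ : Fin n => μ)
      ≤ ENNReal.ofReal (2 / (∑ k, a k ^ 2 + 2 * T⁻¹)) := by
  have hm : 0 ≤ ∑ k, a k ^ 2 := Finset.sum_nonneg fun k _ => sq_nonneg _
  have hc : 0 < T⁻¹ := inv_pos.2 hT
  rw [lintegral_lintegral_swap (by unfold Function.uncurry; fun_prop)]
  by_cases h : ∀ k, 2 * a k ^ 2 ≤ ∑ i, a i ^ 2 + 2 * T⁻¹
  · have hfin : ∀ x : Fin n → EuclideanSpace ℝ (Fin 4),
        ∫⁻ l in Ioc 0 T, ENNReal.ofReal (exp (-(l * ‖∑ k, a k • x k‖ ^ 2)))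
        = ENNReal.ofReal (∫ l in (0 : ℝ)..(T⁻¹)⁻¹, exp (-(l * ‖∑ k, a k • x k‖ ^ 2))) := by
      intro x
      rw [inv_inv, intervalIntegral.integral_of_le hT.le, ofReal_integral_eq_lintegral_ofReal
        (Continuous.integrableOn_Ioc (by fun_prop)) (ae_of_all _ fun _ => (exp_pos _).le)]
    have hnn : ∀ x : Fin n → EuclideanSpace ℝ (Fin 4),
        0 ≤ ∫ l in (0 : ℝ)..(T⁻¹)⁻¹, exp (-(l * ‖∑ k, a k • x k‖ ^ 2)) := fun x =>
      intervalIntegral.integral_nonneg (by simpa using hT.le) fun _ _ => (exp_pos _).le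
    have hcont : Continuous fun x : Fin n → EuclideanSpace ℝ (Fin 4) =>
        ∫ l in (0 : ℝ)..(T⁻¹)⁻¹, exp (-(l * ‖∑ k, a k • x k‖ ^ 2)) :=
      intervalIntegral.continuous_parametric_intervalIntegral_of_continuous'
        (by unfold Function.uncurry; fun_prop) _ _
    have hint : Integrable (fun x : Fin n → EuclideanSpace ℝ (Fin 4) =>
        ∫ l in (0 : ℝ)..(T⁻¹)⁻¹, exp (-(l * ‖∑ k, a k • x k‖ ^ 2)))
        (Measure.pi fun _ : Fin n => μ) := by
      refine Integrable.of_bound hcont.aestronglyMeasurable (1 * |(T⁻¹)⁻¹ - 0|)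
        (ae_of_all _ fun x => intervalIntegral.norm_integral_le_of_norm_le_const fun l hl => ?_)
      rw [uIoc_of_le (by simpa using hT.le)] at hl
      have := hl.1.le
      rw [Real.norm_eq_abs, abs_exp, exp_le_one_iff]
      have : 0 ≤ l * ‖∑ k, a k • x k‖ ^ 2 := by positivity
      linarith
    simp only [hfin]
    rw [← ofReal_integral_eq_lintegral_ofReal hint (ae_of_all _ hnn),
      hμ.integral_laplace_norm_sum_sq_eq a hc]
    refine le_trans ?_ (setLIntegral_abs_prod_besselSeries_one_le (fun k => sq_nonneg (a k)) hc h)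
    refine (ENNReal.ofReal_le_ofReal (le_abs_self _)).trans ?_
    rw [← Real.norm_eq_abs, ofReal_norm]
    refine (enorm_integral_le_lintegral_enorm _).trans (le_of_eq ?_)
    refine lintegral_congr fun t => ?_
    rw [← ofReal_norm, norm_mul, Real.norm_eq_abs, Real.norm_eq_abs, abs_exp]
  · push Not at h
    obtain ⟨i, hi⟩ := h
    have hai : a i ≠ 0 := by
      intro h0
      rw [h0] at hi
      linarith
    calc _ ≤ ∫⁻ x, (ENNReal.ofReal (‖∑ k, a k • x k‖ ^ 2))⁻¹ ∂(Measure.pi fun _ : Fin n => μ) :=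
          lintegral_mono fun x => (lintegral_mono_set Ioc_subset_Ioi_self).trans
            (lintegral_Ioi_exp_neg_mul_le _ (sq_nonneg _))
      _ ≤ ENNReal.ofReal (a i ^ 2)⁻¹ := hμ.lintegral_inv_norm_sum_sq_le a i hai
      _ ≤ _ := by
        refine ENNReal.ofReal_le_ofReal ?_
        have : 0 < a i ^ 2 := by positivity
        rw [inv_eq_one_div, div_le_div_iff₀ this (by positivity)]
        linarith

end IsUniformOnSphere

lemma setLIntegral_Ioi_rpow_mul_exp_neg_mul {q v : ℝ} (hq : 0 < q) (hv : 0 ≤ v) :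
    ∫⁻ l in Ioi (0 : ℝ), ENNReal.ofReal (l ^ (q - 1)) * ENNReal.ofReal (exp (-(l * v)))
      = ENNReal.ofReal (Real.Gamma q) * ENNReal.ofReal v ^ (-q) := by
  rcases hv.eq_or_lt with rfl | h
  · rw [ENNReal.ofReal_zero, ENNReal.zero_rpow_of_neg (by linarith), ENNReal.mul_top
      (by simpa using Gamma_pos_of_pos hq)]
    by_contra hne
    apply not_integrableOn_Ioi_rpow (q - 1)
    refine ⟨by fun_prop, ?_⟩
    rw [hasFiniteIntegral_iff_ofReal]
    · simpa [lt_top_iff_ne_top] using hne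
    · filter_upwards [ae_restrict_mem measurableSet_Ioi] with l hl
      exact rpow_nonneg (le_of_lt hl) _
  · have h1 := integrableOn_rpow_mul_exp_neg_mul_rpow (s := q - 1) (p := 1) (b := v)
      (by linarith) one_pos h
    have h2 := integral_rpow_mul_exp_neg_mul_Ioi hq h
    have e : ∀ l : ℝ, -v * l ^ (1 : ℝ) = -(v * l) := fun l => by rw [rpow_one]; ring
    simp only [e] at h1
    calc _ = ∫⁻ l in Ioi (0 : ℝ), ENNReal.ofReal (l ^ (q - 1) * exp (-(v * l))) :=
          setLIntegral_congr_fun measurableSet_Ioi fun l hl => by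
            rw [ENNReal.ofReal_mul (rpow_nonneg (le_of_lt hl) _), mul_comm v]
      _ = ENNReal.ofReal ((1 / v) ^ q * Real.Gamma q) := by
          rw [← h2, ofReal_integral_eq_lintegral_ofReal h1]
          filter_upwards [ae_restrict_mem measurableSet_Ioi] with l hl
          exact mul_nonneg (rpow_nonneg (le_of_lt hl) _) (exp_pos _).le
      _ = _ := by
          rw [mul_comm, ENNReal.ofReal_mul (Gamma_pos_of_pos hq).le, one_div, inv_rpow hv,
            ← rpow_neg hv, ENNReal.ofReal_rpow_of_pos h]

lemma setLIntegral_Ioi_one_sub_mul_rpow {q l : ℝ} (hq : q < 1) (hl : 0 < l) :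
    ∫⁻ t in Ioi l, ENNReal.ofReal ((1 - q) * t ^ (q - 2)) = ENNReal.ofReal (l ^ (q - 1)) := by
  rw [← ofReal_integral_eq_lintegral_ofReal
    ((integrableOn_Ioi_rpow_of_lt (by linarith) hl).const_mul _),
    integral_const_mul, integral_Ioi_rpow_of_lt (by linarith) hl,
    show q - 2 + 1 = q - 1 by ring]
  · congr 1
    have : q - 1 ≠ 0 := by linarith
    field_simp
    ring
  · filter_upwards [ae_restrict_mem measurableSet_Ioi] with t ht
    exact mul_nonneg (by linarith) (rpow_nonneg (hl.trans ht).le _)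

lemma setLIntegral_Ioi_rpow_mul_eq {q : ℝ} (hq : q < 1) {f : ℝ → ℝ≥0∞} (hf : Measurable f) :
    ∫⁻ l in Ioi (0 : ℝ), ENNReal.ofReal (l ^ (q - 1)) * f l
      = ∫⁻ t in Ioi (0 : ℝ), ENNReal.ofReal ((1 - q) * t ^ (q - 2)) * ∫⁻ l in Ioc 0 t, f l := by
  have hk : Measurable fun t : ℝ => ENNReal.ofReal ((1 - q) * t ^ (q - 2)) := by fun_prop
  have hm : Measurable (Function.uncurry fun (l t : ℝ) =>
      (Iio t).indicator (fun l => ENNReal.ofReal ((1 - q) * t ^ (q - 2)) * f l) l) := by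
    have : (Function.uncurry fun (l t : ℝ) =>
        (Iio t).indicator (fun l => ENNReal.ofReal ((1 - q) * t ^ (q - 2)) * f l) l)
        = {z : ℝ × ℝ | z.1 < z.2}.indicator
          (fun z => ENNReal.ofReal ((1 - q) * z.2 ^ (q - 2)) * f z.1) := by
      ext z
      simp [Function.uncurry, indicator]
    rw [this]
    refine Measurable.indicator ?_ (measurableSet_lt measurable_fst measurable_snd)
    exact (hk.comp measurable_snd).mul (hf.comp measurable_fst)
  calc _ = ∫⁻ l in Ioi (0 : ℝ), ∫⁻ t in Ioi (0 : ℝ),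
          (Iio t).indicator (fun l => ENNReal.ofReal ((1 - q) * t ^ (q - 2)) * f l) l := by
        refine setLIntegral_congr_fun measurableSet_Ioi fun l hl => ?_
        have hl0 : (0 : ℝ) < l := hl
        have : ∀ t : ℝ, (Iio t).indicator
            (fun l => ENNReal.ofReal ((1 - q) * t ^ (q - 2)) * f l) l
            = (Ioi l).indicator (fun t => ENNReal.ofReal ((1 - q) * t ^ (q - 2)) * f l) t := by
          intro t
          simp [indicator]
        simp only [this]
        rw [lintegral_indicator measurableSet_Ioi, Measure.restrict_restrict measurableSet_Ioi,
          inter_eq_left.2 (Ioi_subset_Ioi hl0.le), lintegral_mul_const _ hk,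
          setLIntegral_Ioi_one_sub_mul_rpow hq hl0]
    _ = ∫⁻ t in Ioi (0 : ℝ), ∫⁻ l in Ioi (0 : ℝ),
          (Iio t).indicator (fun l => ENNReal.ofReal ((1 - q) * t ^ (q - 2)) * f l) l :=
        lintegral_lintegral_swap hm.aemeasurable
    _ = _ := by
        refine lintegral_congr fun t => ?_
        rw [lintegral_indicator measurableSet_Iio, Measure.restrict_restrict measurableSet_Iio,
          lintegral_const_mul _ hf, inter_comm, Ioi_inter_Iio,
          restrict_Ioo_eq_restrict_Ioc]

lemma setLIntegral_Ioi_rpow_mul_mono {q : ℝ} (hq1 : q ≤ 1) {f g : ℝ → ℝ≥0∞}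
    (hf : Measurable f) (hg : Measurable g)
    (h : ∀ t, 0 < t → ∫⁻ l in Ioc 0 t, f l ≤ ∫⁻ l in Ioc 0 t, g l) :
    ∫⁻ l in Ioi (0 : ℝ), ENNReal.ofReal (l ^ (q - 1)) * f l
      ≤ ∫⁻ l in Ioi (0 : ℝ), ENNReal.ofReal (l ^ (q - 1)) * g l := by
  rcases hq1.eq_or_lt with rfl | hq
  · simp only [sub_self, rpow_zero, ENNReal.ofReal_one, one_mul]
    have hU : Ioi (0 : ℝ) = ⋃ n : ℕ, Ioc (0 : ℝ) n := by
      ext x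
      simp only [mem_Ioi, mem_iUnion, mem_Ioc]
      exact ⟨fun hx => (exists_nat_ge x).imp fun _ hn => ⟨hx, hn⟩, fun ⟨_, hx, _⟩ => hx⟩
    have hdir : Directed (· ⊆ ·) fun n : ℕ => Ioc (0 : ℝ) n :=
      Monotone.directed_le fun m n hmn => Ioc_subset_Ioc_right (by exact_mod_cast hmn)
    rw [hU, setLIntegral_iUnion_of_directed _ hdir, ← hU]
    refine iSup_le fun n => ?_
    rcases Nat.eq_zero_or_pos n with rfl | hn
    · simp
    · exact (h n (by exact_mod_cast hn)).trans (lintegral_mono_set Ioc_subset_Ioi_self)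
  · rw [setLIntegral_Ioi_rpow_mul_eq hq hf, setLIntegral_Ioi_rpow_mul_eq hq hg]
    exact setLIntegral_mono' measurableSet_Ioi fun t ht => mul_le_mul_right (h t ht) _

lemma ofReal_Gamma_mul_lintegral_rpow_neg {α : Type*} [MeasurableSpace α] (ν : Measure α)
    [SFinite ν] {q : ℝ} (hq : 0 < q) {V : α → ℝ} (hV : Measurable V) (hV0 : ∀ x, 0 ≤ V x) :
    ENNReal.ofReal (Real.Gamma q) * ∫⁻ x, ENNReal.ofReal (V x) ^ (-q) ∂ν
      = ∫⁻ l in Ioi (0 : ℝ), ENNReal.ofReal (l ^ (q - 1)) *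
        ∫⁻ x, ENNReal.ofReal (exp (-(l * V x))) ∂ν := by
  rw [← lintegral_const_mul' _ _ (by simp)]
  simp only [← setLIntegral_Ioi_rpow_mul_exp_neg_mul hq (hV0 _)]
  rw [lintegral_lintegral_swap (by unfold Function.uncurry; fun_prop)]
  refine lintegral_congr fun l => ?_
  rw [lintegral_const_mul' _ _ (by simp)]

lemma lintegral_rpow_neg_mono {α β : Type*} [MeasurableSpace α] [MeasurableSpace β]
    (ν : Measure α) [SFinite ν] (ρ : Measure β) [SFinite ρ] {q : ℝ} (hq : 0 < q) (hq1 : q ≤ 1)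
    {V : α → ℝ} (hV : Measurable V) (hV0 : ∀ x, 0 ≤ V x)
    {W : β → ℝ} (hW : Measurable W) (hW0 : ∀ x, 0 ≤ W x)
    (h : ∀ t, 0 < t → ∫⁻ l in Ioc 0 t, ∫⁻ x, ENNReal.ofReal (exp (-(l * V x))) ∂ν
      ≤ ∫⁻ l in Ioc 0 t, ∫⁻ x, ENNReal.ofReal (exp (-(l * W x))) ∂ρ) :
    ∫⁻ x, ENNReal.ofReal (V x) ^ (-q) ∂ν ≤ ∫⁻ x, ENNReal.ofReal (W x) ^ (-q) ∂ρ := by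
  have hΓ : ENNReal.ofReal (Real.Gamma q) ≠ 0 := by simpa using Gamma_pos_of_pos hq
  rw [← ENNReal.mul_le_mul_iff_right hΓ (by simp),
    ofReal_Gamma_mul_lintegral_rpow_neg ν hq hV hV0,
    ofReal_Gamma_mul_lintegral_rpow_neg ρ hq hW hW0]
  exact setLIntegral_Ioi_rpow_mul_mono hq1
    (Measurable.lintegral_prod_right (by unfold Function.uncurry; fun_prop))
    (Measurable.lintegral_prod_right (by unfold Function.uncurry; fun_prop)) h

lemma setLIntegral_Ioc_inv_one_add_mul_sq {b t : ℝ} (hb : 0 < b) (ht : 0 < t) :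
    ∫⁻ l in Ioc 0 t, ENNReal.ofReal (((1 + l * b) ^ 2)⁻¹) = ENNReal.ofReal (t / (1 + t * b)) := by
  have hpos : ∀ l ∈ uIcc 0 t, 0 < 1 + l * b := fun l hl => by
    rw [uIcc_of_le ht.le] at hl
    have := mul_nonneg hl.1 hb.le
    linarith
  have hcont : ContinuousOn (fun l : ℝ => ((1 + l * b) ^ 2)⁻¹) (uIcc 0 t) :=
    ContinuousOn.inv₀ (by fun_prop) fun l hl => (pow_pos (hpos l hl) 2).ne'
  have hint : IntervalIntegrable (fun l : ℝ => ((1 + l * b) ^ 2)⁻¹) volume 0 t :=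
    hcont.intervalIntegrable
  have hd : ∀ l ∈ uIcc 0 t,
      HasDerivAt (fun l : ℝ => l / (1 + l * b)) (((1 + l * b) ^ 2)⁻¹) l := fun l hl => by
    have h1 : HasDerivAt (fun l : ℝ => 1 + l * b) b l := by
      simpa using ((hasDerivAt_id l).mul_const b).const_add 1
    refine ((hasDerivAt_id' l).fun_div h1 (hpos l hl).ne').congr_deriv ?_
    rw [inv_eq_one_div]
    congr 1
    ring
  have := intervalIntegral.integral_eq_sub_of_hasDerivAt hd hint
  rw [intervalIntegral.integral_of_le ht.le] at this
  rw [← ofReal_integral_eq_lintegral_ofReal hint.1 (ae_of_all _ fun l => by positivity), this]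
  simp

lemma lintegral_rpow_neg_le_of_laplace {α : Type*} [MeasurableSpace α] (ν : Measure α)
    [SFinite ν] {q : ℝ} (hq : 0 < q) (hq1 : q ≤ 1) {V : α → ℝ} (hV : Measurable V)
    (hV0 : ∀ x, 0 ≤ V x) {m : ℝ} (hm : 0 < m)
    (h : ∀ t, 0 < t → ∫⁻ l in Ioc 0 t, ∫⁻ x, ENNReal.ofReal (exp (-(l * V x))) ∂ν
      ≤ ENNReal.ofReal (2 / (m + 2 * t⁻¹))) :
    ∫⁻ x, ENNReal.ofReal (V x) ^ (-q) ∂ν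
      ≤ ENNReal.ofReal (2 ^ q * Real.Gamma (2 - q) * m ^ (-q)) := by
  let ρ : Measure ℝ := (volume.restrict (Ioi 0)).withDensity fun x => ENNReal.ofReal (x * exp (-x))
  have hρ : ∀ f : ℝ → ℝ≥0∞, Measurable f →
      ∫⁻ x, f x ∂ρ = ∫⁻ x in Ioi 0, ENNReal.ofReal (x * exp (-x)) * f x := fun f hf =>
    lintegral_withDensity_eq_lintegral_mul _ (by fun_prop) hf
  have hW : Measurable fun x : ℝ => |x| * (m / 2) := by fun_prop
  refine (lintegral_rpow_neg_mono ν ρ hq hq1 hV hV0 hW (fun x => by positivity)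
    fun t ht => ?_).trans (le_of_eq ?_)
  · refine (h t ht).trans (le_of_eq ?_)
    have hlap : ∀ l ∈ Ioc 0 t, ∫⁻ x, ENNReal.ofReal (exp (-(l * (|x| * (m / 2))))) ∂ρ
        = ENNReal.ofReal (((1 + l * (m / 2)) ^ 2)⁻¹) := by
      intro l hl
      have hc : 0 < 1 + l * (m / 2) := by have := hl.1; positivity
      have h1 := integrableOn_pow_mul_exp_neg_mul 1 hc
      have h2 := integral_pow_mul_exp_neg_mul 1 hc
      rw [hρ _ (by fun_prop)]
      calc _ = ∫⁻ x in Ioi 0, ENNReal.ofReal (x ^ 1 * exp (-((1 + l * (m / 2)) * x))) :=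
            setLIntegral_congr_fun measurableSet_Ioi fun x hx => by
              have hx0 : (0 : ℝ) < x := hx
              rw [← ENNReal.ofReal_mul (by positivity), abs_of_pos hx0, mul_assoc, ← exp_add,
                pow_one]
              ring_nf
        _ = _ := by
            rw [← ofReal_integral_eq_lintegral_ofReal h1, h2]
            · simp
            · filter_upwards [ae_restrict_mem measurableSet_Ioi] with x hx
              have hx0 : (0 : ℝ) < x := hx
              simp only [Pi.zero_apply]
              positivity
    rw [setLIntegral_congr_fun measurableSet_Ioc hlap,
      setLIntegral_Ioc_inv_one_add_mul_sq (by positivity) ht]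
    congr 1
    field_simp
    ring
  · rw [hρ _ (by fun_prop)]
    have hs : 0 < 2 - q := by linarith
    have hb : 0 < m / 2 := by positivity
    calc _ = ∫⁻ x in Ioi (0 : ℝ),
          ENNReal.ofReal ((m / 2) ^ (-q) * (exp (-x) * x ^ (2 - q - 1))) :=
          setLIntegral_congr_fun measurableSet_Ioi fun x hx => by
            have hx0 : (0 : ℝ) < x := hx
            rw [abs_of_pos hx0, ENNReal.ofReal_rpow_of_pos (by positivity),
              ← ENNReal.ofReal_mul (by positivity), mul_rpow hx0.le hb.le,
              show 2 - q - 1 = 1 + -q by ring, rpow_add hx0, rpow_one]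
            ring_nf
      _ = ENNReal.ofReal ((m / 2) ^ (-q) * Real.Gamma (2 - q)) := by
          rw [← ofReal_integral_eq_lintegral_ofReal ((GammaIntegral_convergent hs).const_mul _),
            integral_const_mul, Gamma_eq_integral hs]
          filter_upwards [ae_restrict_mem measurableSet_Ioi] with x hx
          have hx0 : (0 : ℝ) < x := hx
          simp only [Pi.zero_apply]
          positivity
      _ = _ := by
          congr 1
          rw [div_rpow hm.le (by norm_num), rpow_neg (by norm_num : (0 : ℝ) ≤ 2), div_inv_eq_mul]
          ring

/-- For `0 < p ≤ 2`, sums `S = ∑ aₖ ξₖ` of independent random vectors uniform on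
the unit sphere `S³` in `ℝ⁴` satisfy `E|S|^{-p} ≤ 2^{p/2} Γ(2 - p/2) (∑ aₖ²)^{-p/2}`. -/
theorem neg_moment_bound_dim_four_gaussian_constant
    (p : ℝ) (hp : 0 < p) (hp2 : p ≤ 2)
    (μ : Measure (EuclideanSpace ℝ (Fin 4))) [IsProbabilityMeasure μ]
    (hμ : IsUniformOnSphere μ)
    (n : ℕ) (hn : 1 ≤ n) (a : Fin n → ℝ) (ha : a ≠ 0) :
    ∫⁻ x, (‖∑ k, a k • x k‖₊ : ℝ≥0∞) ^ (-p) ∂(Measure.pi fun _ : Fin n => μ)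
      ≤ ENNReal.ofReal ((2 : ℝ) ^ (p / 2) * Real.Gamma (2 - p / 2) *
          (∑ k, (a k) ^ 2) ^ (-p / 2)) := by
  obtain ⟨i, hi⟩ := Function.ne_iff.1 ha
  have hm : 0 < ∑ k, a k ^ 2 :=
    Finset.sum_pos' (fun k _ => sq_nonneg _) ⟨i, Finset.mem_univ _, sq_pos_of_ne_zero hi⟩
  have key := lintegral_rpow_neg_le_of_laplace (Measure.pi fun _ : Fin n => μ)
    (q := p / 2) (by linarith) (by linarith) (V := fun x => ‖∑ k, a k • x k‖ ^ 2)
    (by fun_prop) (fun x => sq_nonneg _) hm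
    fun t ht => hμ.setLIntegral_laplace_norm_sum_sq_le ht
  rw [neg_div]
  refine le_trans (le_of_eq (lintegral_congr fun x => ?_)) key
  rw [ENNReal.ofReal_pow (norm_nonneg _), ofReal_norm, ← ENNReal.rpow_natCast,
    ← ENNReal.rpow_mul]
  congr 1
  push_cast
  ring
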